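/- arXiv:1912.06531 — 3 statements merged into one kernel-verified Lean document; each statement's English description precedes it below -/
import Mathlib

section
/- Suppose X is a reflexive and separable real Banach space and let x̄ ∈ F be a feasible point of problem (P). Then for every v in the Fréchet normal cone N̂_F(x̄) there exists a continuously Fréchet differentiable function h : X → ℝ with h'(x̄) = −v such that h restricted to F attains a unique global minimum at x̄; moreover, h is weakly sequentially lower semicontinuous. -/
open Filter Topology MeasureTheory

section AKKTDefs

variable {X Y : Type*} [NormedAddCommGroup X] [NormedSpace ℝ X]
  [NormedAddCommGroup Y] [NormedSpace ℝ Y]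

/-- The normal cone (in the sense of convex analysis) to `C` at `x`;
it is empty whenever `x ∉ C`. -/
def normalCone (C : Set X) (x : X) : Set (X →L[ℝ] ℝ) :=
  {v | x ∈ C ∧ ∀ z ∈ C, v (z - x) ≤ 0}

/-- The polar cone of a set `A ⊆ X`, as a subset of the topological dual. -/
def polarCone (A : Set X) : Set (X →L[ℝ] ℝ) :=
  {v | ∀ x ∈ A, v x ≤ 0}

/-- The recession cone of `S`: all `d` with `d + S ⊆ S`. -/
def recessionCone (S : Set X) : Set X :=
  {d | ∀ x ∈ S, d + x ∈ S}

/-- The radial cone (cone of feasible directions) of `S` at `x0`. -/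
def radialCone (S : Set X) (x0 : X) : Set X :=
  {d | ∃ α : ℝ, 0 ≤ α ∧ ∃ x ∈ S, d = α • (x - x0)}

/-- Weak sequential convergence `x k ⇀ x0`. -/
def WeakSeqConv (x : ℕ → X) (x0 : X) : Prop :=
  ∀ φ : X →L[ℝ] ℝ, Tendsto (fun k => φ (x k)) atTop (𝓝 (φ x0))

/-- Weak-* sequential convergence of functionals `v k →* v0`. -/
def WeakStarSeqConv (v : ℕ → X →L[ℝ] ℝ) (v0 : X →L[ℝ] ℝ) : Prop :=
  ∀ z : X, Tendsto (fun k => v k z) atTop (𝓝 (v0 z))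

/-- `r^k ↓ 0`: nonnegative, monotonically decreasing, converging to `0`. -/
def DownTo0 (r : ℕ → ℝ) : Prop :=
  (∀ k, 0 ≤ r k) ∧ Antitone r ∧ Tendsto r atTop (𝓝 0)

/-- The (Bouligand) tangent cone to `Q` at `x0`. -/
def tangentCone (Q : Set X) (x0 : X) : Set X :=
  {d | ∃ (x : ℕ → X) (t : ℕ → ℝ), (∀ k, x k ∈ Q) ∧ (∀ k, 0 < t k) ∧ Antitone t ∧
    Tendsto t atTop (𝓝 0) ∧ Tendsto x atTop (𝓝 x0) ∧
    Tendsto (fun k => (t k)⁻¹ • (x k - x0)) atTop (𝓝 d)}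

/-- The weak tangent cone to `Q` at `x0`. -/
def weakTangentCone (Q : Set X) (x0 : X) : Set X :=
  {d | ∃ (x : ℕ → X) (t : ℕ → ℝ), (∀ k, x k ∈ Q) ∧ (∀ k, 0 < t k) ∧ Antitone t ∧
    Tendsto t atTop (𝓝 0) ∧ Tendsto x atTop (𝓝 x0) ∧
    WeakSeqConv (fun k => (t k)⁻¹ • (x k - x0)) d}

/-- The Clarke tangent cone to `Q` at `x0`. -/
def clarkeTangentCone (Q : Set X) (x0 : X) : Set X :=
  {d | ∀ (x : ℕ → X) (t : ℕ → ℝ), (∀ k, x k ∈ Q) → Tendsto x atTop (𝓝 x0) →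
    (∀ k, 0 < t k) → Antitone t → Tendsto t atTop (𝓝 0) →
    ∃ dk : ℕ → X, Tendsto dk atTop (𝓝 d) ∧ ∀ k, x k + t k • dk k ∈ Q}

/-- The Fréchet (regular) normal cone to `Q` at `x0`. -/
def frechetNormalCone (Q : Set X) (x0 : X) : Set (X →L[ℝ] ℝ) :=
  {v | ∀ ε > 0, ∃ δ > 0, ∀ x ∈ Q, ‖x - x0‖ ≤ δ → v (x - x0) ≤ ε * ‖x - x0‖}

/-- A normed space is reflexive if the canonical embedding into the double dual
is surjective. -/
def IsReflexiveSpace (Z : Type*) [NormedAddCommGroup Z] [NormedSpace ℝ Z] : Prop :=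
  Function.Surjective (NormedSpace.inclusionInDoubleDual ℝ Z)

/-- The set `M(x, r)` of inexact KKT multiples:
`M(x,r) = {G'(x)*λ + μ : μ ∈ N_C(x), ⟨λ, y - G(x)⟩ ≤ r ∀ y ∈ K}`. -/
def Mset (G : X → Y) (G' : X → X →L[ℝ] Y) (C : Set X) (K : Set Y)
    (x : X) (r : ℝ) : Set (X →L[ℝ] ℝ) :=
  {v | ∃ (l : Y →L[ℝ] ℝ) (μ : X →L[ℝ] ℝ), μ ∈ normalCone C x ∧
    (∀ y ∈ K, l (y - G x) ≤ r) ∧ v = l.comp (G' x) + μ}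

/-- KKT point of problem (P). -/
def KKTPoint (f' : X → X →L[ℝ] ℝ) (G : X → Y) (G' : X → X →L[ℝ] Y)
    (C : Set X) (K : Set Y) (x0 : X) : Prop :=
  ∃ l : Y →L[ℝ] ℝ, (-(f' x0) - l.comp (G' x0)) ∈ normalCone C x0 ∧
    l ∈ normalCone K (G x0)

/-- `x0` is an s-AKKT point: there is an s-AKKT sequence with `x k → x0` in norm. -/
def sAKKTPoint (f' : X → X →L[ℝ] ℝ) (G : X → Y) (G' : X → X →L[ℝ] Y)
    (C : Set X) (K : Set Y) (x0 : X) : Prop :=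
  ∃ (x : ℕ → X) (l : ℕ → Y →L[ℝ] ℝ) (ε : ℕ → X →L[ℝ] ℝ) (r : ℕ → ℝ),
    Tendsto ε atTop (𝓝 0) ∧ DownTo0 r ∧
    (∀ k, (ε k - f' (x k) - (l k).comp (G' (x k))) ∈ normalCone C (x k)) ∧
    (∀ k, ∀ y ∈ K, (l k) (y - G (x k)) ≤ r k) ∧
    Tendsto x atTop (𝓝 x0)

/-- `x0` is a w-AKKT point: there is a w-AKKT sequence with `x k ⇀ x0` weakly. -/
def wAKKTPoint (f' : X → X →L[ℝ] ℝ) (G : X → Y) (G' : X → X →L[ℝ] Y)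
    (C : Set X) (K : Set Y) (x0 : X) : Prop :=
  ∃ (x : ℕ → X) (l : ℕ → Y →L[ℝ] ℝ) (ε : ℕ → X →L[ℝ] ℝ) (r : ℕ → ℝ),
    WeakStarSeqConv ε 0 ∧ DownTo0 r ∧
    (∀ k, (ε k - f' (x k) - (l k).comp (G' (x k))) ∈ normalCone C (x k)) ∧
    (∀ k, ∀ y ∈ K, (l k) (y - G (x k)) ≤ r k) ∧
    WeakSeqConv x x0

/-- s-AKKT regularity at `x0`. -/
def sAKKTRegular (G : X → Y) (G' : X → X →L[ℝ] Y) (C : Set X) (K : Set Y)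
    (x0 : X) : Prop :=
  ∀ (v0 : X →L[ℝ] ℝ) (x : ℕ → X) (r : ℕ → ℝ) (v : ℕ → X →L[ℝ] ℝ),
    Tendsto x atTop (𝓝 x0) → DownTo0 r → Tendsto v atTop (𝓝 v0) →
    (∀ k, v k ∈ Mset G G' C K (x k) (r k)) → v0 ∈ Mset G G' C K x0 0

/-- sw-AKKT regularity at `x0`. -/
def swAKKTRegular (G : X → Y) (G' : X → X →L[ℝ] Y) (C : Set X) (K : Set Y)
    (x0 : X) : Prop :=
  ∀ (v0 : X →L[ℝ] ℝ) (x : ℕ → X) (r : ℕ → ℝ) (v : ℕ → X →L[ℝ] ℝ),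
    Tendsto x atTop (𝓝 x0) → DownTo0 r → WeakStarSeqConv v v0 →
    (∀ k, v k ∈ Mset G G' C K (x k) (r k)) → v0 ∈ Mset G G' C K x0 0

/-- w-AKKT regularity at `x0`. -/
def wAKKTRegular (G : X → Y) (G' : X → X →L[ℝ] Y) (C : Set X) (K : Set Y)
    (x0 : X) : Prop :=
  ∀ (v0 : X →L[ℝ] ℝ) (x : ℕ → X) (r : ℕ → ℝ) (v : ℕ → X →L[ℝ] ℝ),
    WeakSeqConv x x0 → DownTo0 r → WeakStarSeqConv v v0 →
    (∀ k, v k ∈ Mset G G' C K (x k) (r k)) → v0 ∈ Mset G G' C K x0 0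

/-- Condition (CC) from the paper. -/
def CondCC (G : X → Y) (C : Set X) (K : Set Y) : Prop :=
  ∀ (x : ℕ → X) (z : X), (∀ k, x k ∈ C) → z ∈ C → WeakSeqConv x z →
    Tendsto (fun k => Metric.infDist (G (x k)) K) atTop (𝓝 0) → G z ∈ K

end AKKTDefs

section aux
variable {X : Type*} [NormedAddCommGroup X] [NormedSpace ℝ X]

lemma aux_dense [TopologicalSpace.SeparableSpace X] (hrefl : IsReflexiveSpace X) :
    ∃ φ : ℕ → (X →L[ℝ] ℝ), ∀ f : X →L[ℝ] ℝ, f ∈ closure (Submodule.span ℝ (Set.range φ) : Set (X →L[ℝ] ℝ)) := by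
  obtain ⟨u, hu⟩ := TopologicalSpace.exists_dense_seq X
  choose φ hφ1 hφ2 using fun n => exists_dual_vector'' ℝ (u n)
  refine ⟨φ, ?_⟩
  intro f
  by_contra hf
  set S := Submodule.span ℝ (Set.range φ)
  have hcl : (closure (S : Set (X →L[ℝ] ℝ))) = (S.topologicalClosure : Set (X →L[ℝ] ℝ)) :=
    (Submodule.topologicalClosure_coe S).symm
  obtain ⟨F, r, hF1, hF2⟩ := geometric_hahn_banach_closed_point (s := closure (S : Set (X →L[ℝ] ℝ)))
    (by rw [hcl]; exact Submodule.convex _) isClosed_closure hf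
  have hr : 0 < r := by
    have := hF1 0 (subset_closure S.zero_mem)
    simpa using this
  have hzero : ∀ n, F (φ n) = 0 := by
    intro n
    by_contra hne
    have h1 := hF1 ((r / F (φ n)) • φ n)
      (subset_closure (S.smul_mem _ (Submodule.subset_span ⟨n, rfl⟩)))
    rw [map_smul, smul_eq_mul, div_mul_cancel₀ _ hne] at h1
    exact lt_irrefl _ h1
  obtain ⟨x, rfl⟩ := hrefl F
  have hx : x ≠ 0 := by
    rintro rfl
    simp at hF2
    linarith
  have hxn : 0 < ‖x‖ := norm_pos_iff.2 hx
  obtain ⟨n, hn⟩ := hu.exists_dist_lt x (half_pos hxn)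
  have e1 : φ n x = 0 := by simpa using hzero n
  have e2 : φ n (u n) = ‖u n‖ := by simpa using hφ2 n
  have e3 : ‖φ n (u n - x)‖ ≤ 1 * ‖u n - x‖ :=
    (φ n).le_of_opNorm_le (hφ1 n) _
  rw [map_sub, e1, e2, sub_zero, norm_norm] at e3
  rw [dist_eq_norm] at hn
  have e4 : ‖u n - x‖ = ‖x - u n‖ := norm_sub_rev _ _
  have e5 : ‖x‖ ≤ ‖x - u n‖ + ‖u n‖ := by
    simpa using norm_add_le (x - u n) (u n)
  linarith

lemma aux_lsc {W : Type*} [NormedAddCommGroup W] [NormedSpace ℝ W] (T : W →L[ℝ] X) :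
    LowerSemicontinuous (fun f : WeakDual ℝ X => ‖(WeakDual.toStrongDual f : X →L[ℝ] ℝ).comp T‖) := by
  intro f r hr
  obtain ⟨w, hw, hw2⟩ := ContinuousLinearMap.exists_lt_apply_of_lt_opNorm _ hr
  have hc : Continuous fun g : WeakDual ℝ X => ‖g (T w)‖ := (WeakDual.eval_continuous (T w)).norm
  have := (hc.tendsto f).eventually (lt_mem_nhds hw2)
  filter_upwards [this] with g hg
  refine hg.trans_le ?_
  have := ((WeakDual.toStrongDual g : X →L[ℝ] ℝ).comp T).le_opNorm w
  refine le_trans this ?_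
  exact mul_le_of_le_one_right (norm_nonneg _) hw.le

/-- approximate finite-dimensional functionals -/
lemma aux_lur (φ : ℕ → (X →L[ℝ] ℝ)) (hφ : ∀ f : X →L[ℝ] ℝ, f ∈ closure (Submodule.span ℝ (Set.range φ) : Set (X →L[ℝ] ℝ)))
    (u : ℕ → X) (hu : DenseRange u)
    (f : ℕ → X →L[ℝ] ℝ) (g : X →L[ℝ] ℝ) (B : ℝ) (hB : ∀ k, ‖f k‖ ≤ B)
    (h1 : ∀ n, Tendsto (fun k => ‖(f k).comp (⨅ i : Fin n, LinearMap.ker (φ i : X →ₗ[ℝ] ℝ)).subtypeL‖) atTop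
      (𝓝 ‖g.comp (⨅ i : Fin n, LinearMap.ker (φ i : X →ₗ[ℝ] ℝ)).subtypeL‖))
    (h2 : ∀ n, Tendsto (fun k => f k (u n)) atTop (𝓝 (g (u n)))) :
    Tendsto f atTop (𝓝 g) := by
  -- pointwise convergence
  have hpt : ∀ x, Tendsto (fun k => f k x) atTop (𝓝 (g x)) := by
    intro x
    rw [Metric.tendsto_atTop]
    intro ε hε
    have hB0 : 0 ≤ B := (norm_nonneg _).trans (hB 0)
    have hpos : 0 < B + ‖g‖ + 1 := by positivity
    obtain ⟨n, hn⟩ := hu.exists_dist_lt x (ε := ε / 2 / (B + ‖g‖ + 1)) (by positivity)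
    obtain ⟨N, hN⟩ := Metric.tendsto_atTop.1 (h2 n) (ε / 2) (half_pos hε)
    refine ⟨N, fun k hk => ?_⟩
    have a1 := hN k hk
    rw [dist_eq_norm] at *
    have a2 : f k x - g x = (f k (u n) - g (u n)) + (f k - g) (x - u n) := by
      simp; ring
    have a3 : ‖(f k - g) (x - u n)‖ ≤ (B + ‖g‖ + 1) * ‖x - u n‖ := by
      refine (f k - g).le_of_opNorm_le ?_ _
      have := norm_sub_le (f k) g
      have := hB k
      linarith
    have a4 : (B + ‖g‖ + 1) * ‖x - u n‖ < ε / 2 := by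
      rw [lt_div_iff₀ hpos] at hn; linarith
    rw [a2]
    have := norm_add_le (f k (u n) - g (u n)) ((f k - g) (x - u n))
    linarith
  rw [Metric.tendsto_atTop']
  by_contra hcon
  push Not at hcon
  obtain ⟨ε, hε, hcon⟩ := hcon
  have hη : 0 < ε / 6 := by positivity
  obtain ⟨p, hp, hpg⟩ := Metric.mem_closure_iff.1 (hφ g) (ε / 6) hη
  have hvan : ∃ n, ∀ x, (∀ i < n, φ i x = 0) → p x = 0 := by
    have hp' : p ∈ Submodule.span ℝ (Set.range φ) := hp
    clear hpg hp
    induction hp' using Submodule.span_induction with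
    | mem x hx =>
      obtain ⟨i, rfl⟩ := hx
      exact ⟨i + 1, fun x hx => hx i (Nat.lt_succ_self i)⟩
    | zero => exact ⟨0, fun x _ => rfl⟩
    | add a b _ _ ha hb =>
      obtain ⟨n, hn⟩ := ha
      obtain ⟨m, hm⟩ := hb
      refine ⟨max n m, fun x hx => ?_⟩
      simp [hn x fun i hi => hx i (lt_max_of_lt_left hi), hm x fun i hi => hx i (lt_max_of_lt_right hi)]
    | smul c a _ ha =>
      obtain ⟨n, hn⟩ := ha
      exact ⟨n, fun x hx => by simp [hn x hx]⟩
  obtain ⟨n, hn⟩ := hvan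
  set W : Submodule ℝ X := ⨅ i : Fin n, LinearMap.ker (φ i : X →ₗ[ℝ] ℝ) with hW
  have hWmem : ∀ x ∈ W, ∀ i < n, φ i x = 0 := by
    intro x hx i hi
    rw [hW, Submodule.mem_iInf] at hx
    exact hx ⟨i, hi⟩
  have hgW : ‖g.comp W.subtypeL‖ < ε / 6 := by
    have : g.comp W.subtypeL = (g - p).comp W.subtypeL := by
      ext x
      simp [hn x (hWmem x x.2)]
    rw [this]
    refine lt_of_le_of_lt ?_ hpg
    rw [dist_eq_norm]
    refine ContinuousLinearMap.opNorm_le_bound _ (norm_nonneg _) fun x => ?_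
    exact (g - p).le_opNorm x
  have hev : ∀ᶠ k in atTop, ‖(f k).comp W.subtypeL‖ < ε / 6 := (h1 n).eventually (gt_mem_nhds hgW)
  -- approximation by finite dim
  have happ : ∀ q : X →L[ℝ] ℝ, ∃ a ∈ Submodule.span ℝ (Set.range fun i : Fin n => φ i), ‖q - a‖ ≤ ‖q.comp W.subtypeL‖ := by
    intro q
    obtain ⟨q', hq1, hq2⟩ := exists_extension_norm_eq W (q.comp W.subtypeL)
    refine ⟨q - q', ?_, by simp [hq2]⟩
    have := mem_span_of_iInf_ker_le_ker (L := fun i : Fin n => (φ i : X →ₗ[ℝ] ℝ)) (K := ((q - q' : X →L[ℝ] ℝ) : X →ₗ[ℝ] ℝ)) (by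
      intro x hx
      have := hq1 ⟨x, hx⟩
      simp at this
      simp [this])
    rw [Submodule.mem_span_range_iff_exists_fun] at this ⊢
    obtain ⟨c, hc⟩ := this
    refine ⟨c, ?_⟩
    ext x
    have := congrArg (fun l : X →ₗ[ℝ] ℝ => l x) hc
    simpa using this
  set V := Submodule.span ℝ (Set.range fun i : Fin n => φ i) with hV
  have : FiniteDimensional ℝ V := FiniteDimensional.span_of_finite ℝ (Set.finite_range _)
  have : ProperSpace V := FiniteDimensional.proper ℝ V
  choose a ha1 ha2 using fun k => happ (f k - g)
  have hcomp : ∀ k, ‖(f k - g).comp W.subtypeL‖ ≤ ‖(f k).comp W.subtypeL‖ + ‖g.comp W.subtypeL‖ := by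
    intro k
    rw [ContinuousLinearMap.sub_comp]
    have := norm_sub_le ((f k).comp W.subtypeL) (g.comp W.subtypeL)
    exact this
  have hfreq : ∃ᶠ k in atTop, ε ≤ dist (f k) g := by
    rw [frequently_atTop']
    exact hcon
  obtain ⟨θ, hθm, hθ⟩ := extraction_of_frequently_atTop (hfreq.and_eventually hev)
  have hab : ∀ k, ‖(f (θ k) - g) - a (θ k)‖ ≤ ε / 3 := by
    intro k
    have := ha2 (θ k)
    have := hcomp (θ k)
    have := (hθ k).2
    linarith
  let b : ℕ → V := fun k => ⟨a (θ k), ha1 _⟩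
  have hb : ∀ k, b k ∈ Metric.closedBall (0 : V) (B + ‖g‖ + ε / 3) := by
    intro k
    rw [Metric.mem_closedBall, Subtype.dist_eq, dist_eq_norm]
    change ‖a (θ k) - 0‖ ≤ _
    rw [sub_zero]
    have e1 := hab k
    have e2 := norm_sub_le (f (θ k)) g
    have e3 := hB (θ k)
    have e4 : ‖a (θ k)‖ ≤ ‖f (θ k) - g‖ + ‖(f (θ k) - g) - a (θ k)‖ := by
      have := norm_sub_le (f (θ k) - g) ((f (θ k) - g) - a (θ k))
      simpa using this
    linarith
  obtain ⟨c, -, τ, hτ, hc⟩ := (isCompact_closedBall (0 : V) _).tendsto_subseq hb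
  have hc' : Tendsto (fun k => a (θ (τ k))) atTop (𝓝 (c : X →L[ℝ] ℝ)) :=
    (continuous_subtype_val.tendsto c).comp hc
  have hcn : ‖(c : X →L[ℝ] ℝ)‖ ≤ ε / 3 := by
    refine ContinuousLinearMap.opNorm_le_bound _ (by positivity) fun x => ?_
    have t1 : Tendsto (fun k => a (θ (τ k)) x) atTop (𝓝 ((c : X →L[ℝ] ℝ) x)) :=
      ((ContinuousLinearMap.apply ℝ ℝ x).continuous.tendsto _).comp hc'
    have t2 : Tendsto (fun k => f (θ (τ k)) x) atTop (𝓝 (g x)) :=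
      (hpt x).comp ((hθm.comp hτ).tendsto_atTop)
    have t3 : Tendsto (fun k => ‖(f (θ (τ k)) x - g x) - a (θ (τ k)) x‖) atTop
        (𝓝 ‖(g x - g x) - (c : X →L[ℝ] ℝ) x‖) := ((t2.sub_const _).sub t1).norm
    rw [sub_self, zero_sub, norm_neg] at t3
    refine le_of_tendsto' t3 fun k => ?_
    exact ((f (θ (τ k)) - g) - a (θ (τ k))).le_of_opNorm_le (hab _) x
  have t4 : ∀ᶠ k in atTop, ‖a (θ (τ k)) - c‖ < ε / 3 := by
    have := (Metric.tendsto_nhds.1 hc') (ε / 3) (by positivity)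
    simpa [dist_eq_norm] using this
  obtain ⟨k, hk⟩ := t4.exists
  have e1 := (hθ (τ k)).1
  have e2 := hab (τ k)
  rw [dist_eq_norm] at e1
  have e3 : f (θ (τ k)) - g = ((f (θ (τ k)) - g) - a (θ (τ k))) + (a (θ (τ k)) - c) + c := by abel
  have e4 := norm_add₃_le (a := ((f (θ (τ k)) - g) - a (θ (τ k)))) (b := (a (θ (τ k)) - c)) (c := (c : X →L[ℝ] ℝ))
  rw [← e3] at e4
  linarith

end aux

section aux2
variable {X : Type*} [NormedAddCommGroup X] [NormedSpace ℝ X]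

lemma aux_core (q : ℕ → (X →L[ℝ] ℝ) → ℝ) (h0 : ∀ n f, 0 ≤ q n f) (h1 : ∀ n f, q n f ≤ ‖f‖)
    (hmid : ∀ n f g, q n ((1/2 : ℝ) • (f + g)) ≤ (q n f + q n g) / 2)
    (hlsc : ∀ n, LowerSemicontinuous (fun f : WeakDual ℝ X => q n (WeakDual.toStrongDual f)))
    (hlur : ∀ (f : ℕ → X →L[ℝ] ℝ) (g : X →L[ℝ] ℝ) (B : ℝ), (∀ k, ‖f k‖ ≤ B) →
      (∀ n, Tendsto (fun k => q n (f k)) atTop (𝓝 (q n g))) → Tendsto f atTop (𝓝 g)) :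
    ∃ (ψ : X → ℝ) (J : X → X →L[ℝ] ℝ), (∀ x, HasFDerivAt ψ (J x) x) ∧ Continuous J ∧
      (∀ x, ‖J x‖ ≤ ‖x‖) ∧ (∀ x, ‖x‖ ^ 2 / 12 ≤ ψ x) ∧ ψ 0 = 0 ∧
      (∀ (x : ℕ → X) (z : X), (∀ φ : X →L[ℝ] ℝ, Tendsto (fun k => φ (x k)) atTop (𝓝 (φ z))) →
          ∀ c : ℝ, c < ψ z → ∀ᶠ k in atTop, c < ψ (x k)) := by
  set t : ℕ → (X →L[ℝ] ℝ) → ℝ := fun n f => (1/2 : ℝ) ^ n * q n f ^ 2 with ht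
  have ht0 : ∀ n f, 0 ≤ t n f := fun n f => by
    have := h0 n f
    simp only [ht]; positivity
  have htb : ∀ n f, t n f ≤ (1/2 : ℝ) ^ n * ‖f‖ ^ 2 := fun n f => by
    have := h0 n f
    have := h1 n f
    simp only [ht]; gcongr
  have hgs : ∀ f : X →L[ℝ] ℝ, HasSum (fun n : ℕ => (1/2 : ℝ) ^ n * ‖f‖ ^ 2) (2 * ‖f‖ ^ 2) :=
    fun f => hasSum_geometric_two.mul_right _
  have hts : ∀ f, Summable fun n => t n f := fun f =>
    Summable.of_nonneg_of_le (fun n => ht0 n f) (fun n => htb n f) (hgs f).summable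
  set S : (X →L[ℝ] ℝ) → ℝ := fun f => ∑' n, t n f with hS
  set Q : (X →L[ℝ] ℝ) → ℝ := fun f => ‖f‖ ^ 2 + S f with hQ
  have hS0 : ∀ f, 0 ≤ S f := fun f => tsum_nonneg fun n => ht0 n f
  have hQl : ∀ f, ‖f‖ ^ 2 ≤ Q f := fun f => le_add_of_nonneg_right (hS0 f)
  have hQu : ∀ f, Q f ≤ 3 * ‖f‖ ^ 2 := fun f => by
    have := (hts f).tsum_le_tsum (fun n => htb n f) (hgs f).summable
    rw [(hgs f).tsum_eq] at this
    simp only [hQ, hS]; linarith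
  -- lower semicontinuity
  have hQlsc : ∀ x : X, LowerSemicontinuous fun f : WeakDual ℝ X =>
      Q (WeakDual.toStrongDual f) - f x := by
    intro x
    have hnorm : LowerSemicontinuous fun f : WeakDual ℝ X => ‖(WeakDual.toStrongDual f : X →L[ℝ] ℝ)‖ := by
      have := aux_lsc (ContinuousLinearMap.id ℝ X)
      simpa using this
    have hsq : ∀ p : WeakDual ℝ X → ℝ, (∀ f, 0 ≤ p f) → LowerSemicontinuous p →
        ∀ a : ℝ, 0 ≤ a → LowerSemicontinuous fun f => a * p f ^ 2 := by
      intro p hp hl a ha f r hr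
      have hcont : Tendsto (fun s : ℝ => a * s ^ 2) (𝓝 (p f)) (𝓝 (a * p f ^ 2)) :=
        Continuous.tendsto (by fun_prop) _
      by_cases hr0 : r < 0
      · exact Eventually.of_forall fun g => lt_of_lt_of_le hr0 (by positivity)
      have hpf : 0 < p f := by
        rcases (hp f).eq_or_lt with h | h
        · simp [← h] at hr; exact absurd hr hr0
        · exact h
      have hev := (hcont.eventually (lt_mem_nhds hr)).filter_mono (nhdsWithin_le_nhds (s := Set.Iio (p f)))
      have hev2 : ∀ᶠ s in 𝓝[<] (p f), 0 < s := by
        exact (lt_mem_nhds hpf).filter_mono nhdsWithin_le_nhds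
      obtain ⟨s, ⟨hs1, hs2⟩, hs3⟩ := ((hev.and hev2).and self_mem_nhdsWithin).exists
      filter_upwards [hl f s hs3] with g hg
      refine hs1.trans_le ?_
      gcongr
    have hSl : LowerSemicontinuous fun f : WeakDual ℝ X => S (WeakDual.toStrongDual f) := by
      intro f r hr
      have := (hts (WeakDual.toStrongDual f)).hasSum.eventually (lt_mem_nhds hr)
      obtain ⟨F, hF⟩ := this.exists
      have hFl : LowerSemicontinuous fun f : WeakDual ℝ X => ∑ n ∈ F, t n (WeakDual.toStrongDual f) := by
        refine lowerSemicontinuous_sum fun n _ => ?_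
        exact hsq _ (fun f => h0 n _) (hlsc n) _ (by positivity)
      filter_upwards [hFl f r hF] with g hg
      exact hg.trans_le ((hts (WeakDual.toStrongDual g)).sum_le_tsum F fun n _ => ht0 n _)
    have hn2 : LowerSemicontinuous fun f : WeakDual ℝ X => ‖(WeakDual.toStrongDual f : X →L[ℝ] ℝ)‖ ^ 2 := by
      have := hsq _ (fun f => norm_nonneg _) hnorm 1 zero_le_one
      simpa using this
    have hlin : LowerSemicontinuous fun f : WeakDual ℝ X => - f x :=
      (WeakDual.eval_continuous x).neg.lowerSemicontinuous
    have := (hn2.add hSl).add hlin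
    simpa only [sub_eq_add_neg] using this
  -- minimizers
  have hex : ∀ x : X, ∃ f : X →L[ℝ] ℝ, ∀ g : X →L[ℝ] ℝ, Q f - f x ≤ Q g - g x := by
    intro x
    obtain ⟨f, hf, hmin⟩ := LowerSemicontinuousOn.exists_isMinOn (s := WeakDual.toStrongDual ⁻¹' Metric.closedBall (0 : StrongDual ℝ X) ‖x‖)
      ⟨0, by simp⟩ (WeakDual.isCompact_closedBall (𝕜 := ℝ) (E := X) 0 ‖x‖) ((hQlsc x).lowerSemicontinuousOn _)
    rw [isMinOn_iff] at hmin
    refine ⟨WeakDual.toStrongDual f, fun g => ?_⟩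
    by_cases hg : ‖g‖ ≤ ‖x‖
    · have := hmin (StrongDual.toWeakDual g) (by simpa using hg)
      simpa using this
    · push Not at hg
      have h00 := hmin 0 (by simp)
      have hQ0 : Q 0 ≤ 0 := by simpa using hQu 0
      have e1 : Q (WeakDual.toStrongDual f) - f x ≤ 0 := by
        refine h00.trans ?_
        have : (WeakDual.toStrongDual (0 : WeakDual ℝ X)) = (0 : X →L[ℝ] ℝ) := map_zero _
        rw [this]
        change Q 0 - (0 : X →L[ℝ] ℝ) x ≤ 0
        simpa using hQ0
      have e2 : g x ≤ ‖g‖ * ‖x‖ := (le_abs_self _).trans (g.le_opNorm x)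
      have e3 := hQl g
      have e4 : ‖g‖ * ‖x‖ ≤ ‖g‖ ^ 2 := by
        rw [sq]; gcongr
      have : (WeakDual.toStrongDual f) x = f x := rfl
      linarith
  choose J hJ using hex
  have hQ00 : Q 0 = 0 := le_antisymm (by simpa using hQu 0) (by simpa using hQl 0)
  have hJn : ∀ x, ‖J x‖ ≤ ‖x‖ := by
    intro x
    have e1 := hJ x 0
    rw [hQ00] at e1
    simp at e1
    have e2 : J x x ≤ ‖J x‖ * ‖x‖ := (le_abs_self _).trans ((J x).le_opNorm x)
    have e3 := hQl (J x)
    by_contra hc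
    push Not at hc
    nlinarith [norm_nonneg x, norm_nonneg (J x)]
  have hJc : Continuous J := by
    rw [continuous_iff_seqContinuous]
    intro y x hyx
    obtain ⟨B, hB⟩ : ∃ B, ∀ k, ‖y k‖ ≤ B := by
      obtain ⟨B, hB⟩ := (Metric.isBounded_range_of_tendsto y hyx).exists_norm_le
      exact ⟨B, fun k => hB _ ⟨k, rfl⟩⟩
    refine hlur (fun k => J (y k)) (J x) B (fun k => (hJn _).trans (hB k)) fun n => ?_
    have key : ∀ k, (1/2 : ℝ) ^ n * (q n (J (y k)) - q n (J x)) ^ 2 ≤ (B + ‖x‖) * ‖y k - x‖ := by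
      intro k
      set f := J x
      set g := J (y k)
      set m := (1/2 : ℝ) • (f + g) with hm
      have o1 := hJ x m
      have o2 := hJ (y k) m
      have o3 : Q f + Q g - 2 * Q m ≤ (g - f) (y k - x) / 2 := by
        have : m x = (f x + g x) / 2 := by simp [hm]; ring
        have : m (y k) = (f (y k) + g (y k)) / 2 := by simp [hm]; ring
        simp only [sub_apply, map_sub]
        linarith
      have o4 : (g - f) (y k - x) ≤ (B + ‖x‖) * ‖y k - x‖ := by
        refine (le_abs_self _).trans ((g - f).le_of_opNorm_le ?_ _)
        have := norm_sub_le g f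
        have := hJn x
        have := (hJn (y k)).trans (hB k)
        linarith
      have o5 : ‖m‖ ^ 2 * 2 ≤ ‖f‖ ^ 2 + ‖g‖ ^ 2 := by
        have a1 : ‖m‖ ≤ (‖f‖ + ‖g‖) / 2 := by
          rw [hm, norm_smul]
          have := norm_add_le f g
          norm_num
          linarith
        nlinarith [norm_nonneg m, sq_nonneg (‖f‖ - ‖g‖), norm_nonneg f, norm_nonneg g]
      have o6 : ∀ j, (1/2 : ℝ) ^ j * (q j g - q j f) ^ 2 / 2 ≤ t j f + t j g - 2 * t j m := by
        intro j
        have b1 := hmid j f g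
        have b2 := h0 j m
        have b3 : q j m ^ 2 ≤ ((q j f + q j g) / 2) ^ 2 := by gcongr
        have b4 : (q j g - q j f) ^ 2 / 2 ≤ q j f ^ 2 + q j g ^ 2 - 2 * q j m ^ 2 := by
          nlinarith
        have b5 : (0:ℝ) ≤ (1/2) ^ j := by positivity
        have := mul_le_mul_of_nonneg_left b4 b5
        simp only [ht]
        linarith
      have o7 : t n f + t n g - 2 * t n m ≤ S f + S g - 2 * S m := by
        have hs : HasSum (fun j => t j f + t j g - 2 * t j m) (S f + S g - 2 * S m) :=
          ((hts f).hasSum.add (hts g).hasSum).sub ((hts m).hasSum.mul_left 2)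
        refine le_hasSum hs n fun j _ => le_trans ?_ (o6 j)
        positivity
      have o8 := o6 n
      simp only [hQ] at o3
      linarith
    have hlim : Tendsto (fun k => (q n (J (y k)) - q n (J x)) ^ 2) atTop (𝓝 0) := by
      have hu : Tendsto (fun k => 2 ^ n * ((B + ‖x‖) * ‖y k - x‖)) atTop (𝓝 0) := by
        have := (((tendsto_iff_norm_sub_tendsto_zero.1 hyx).const_mul (B + ‖x‖)).const_mul (2 ^ n : ℝ))
        simpa using this
      refine squeeze_zero (fun k => sq_nonneg _) (fun k => ?_) hu
      have h2 : (0:ℝ) ≤ 2 ^ n := by positivity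
      have := mul_le_mul_of_nonneg_left (key k) h2
      rw [← mul_assoc, ← mul_pow] at this
      norm_num at this
      exact this
    have hlim2 := hlim.sqrt
    simp only [Real.sqrt_sq_eq_abs, Real.sqrt_zero] at hlim2
    rw [tendsto_iff_norm_sub_tendsto_zero]
    exact hlim2
  set ψ : X → ℝ := fun x => J x x - Q (J x) with hψ
  have hψg : ∀ x g, g x - Q g ≤ ψ x := fun x g => by
    have := hJ x g
    simp only [hψ]; linarith
  refine ⟨ψ, J, ?_, hJc, hJn, ?_, ?_, ?_⟩
  · intro x
    rw [hasFDerivAt_iff_isLittleO_nhds_zero, Asymptotics.isLittleO_iff]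
    intro c hc
    have hcont : Tendsto (fun h : X => J (x + h)) (𝓝 0) (𝓝 (J x)) := by
      have : Continuous fun h : X => J (x + h) := by fun_prop
      simpa using this.tendsto 0
    filter_upwards [Metric.tendsto_nhds.1 hcont c hc] with h hh
    rw [dist_eq_norm] at hh
    have e1 := hψg (x + h) (J x)
    have e2 := hψg x (J (x + h))
    have e3 : (J (x + h) - J x) h ≤ c * ‖h‖ :=
      (le_abs_self _).trans ((J (x + h) - J x).le_of_opNorm_le hh.le h)
    rw [Real.norm_eq_abs, abs_le]
    have e4 : ψ x = J x x - Q (J x) := rfl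
    have e5 : ψ (x + h) = J (x + h) (x + h) - Q (J (x + h)) := rfl
    simp only [map_add, sub_apply] at e1 e3 e5
    have : 0 ≤ c * ‖h‖ := by positivity
    constructor <;> linarith
  · intro x
    obtain ⟨g, hg1, hg2⟩ := exists_dual_vector'' ℝ x
    have hg2 : g x = ‖x‖ := by simpa using hg2
    have e1 := hψg x ((‖x‖ / 6) • g)
    have e2 := hQu ((‖x‖ / 6) • g)
    have e3 : ‖(‖x‖ / 6) • g‖ ≤ ‖x‖ / 6 := by
      rw [norm_smul, Real.norm_eq_abs, abs_of_nonneg (by positivity)]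
      exact mul_le_of_le_one_right (by positivity) hg1
    have e4 : ‖(‖x‖ / 6) • g‖ ^ 2 ≤ (‖x‖ / 6) ^ 2 := by gcongr
    have e5 : ((‖x‖ / 6) • g) x = ‖x‖ / 6 * ‖x‖ := by simp [hg2]
    rw [e5] at e1
    nlinarith
  · have e1 := hψg 0 0
    rw [hQ00] at e1
    have e2 : ψ 0 = J 0 0 - Q (J 0) := rfl
    have e3 := hQl (J 0)
    have e4 : 0 ≤ ‖J 0‖ ^ 2 := by positivity
    simp only [map_zero, sub_zero] at e1 e2
    linarith
  · intro x z hxz c hc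
    have := ((hxz (J z)).sub_const (Q (J z))).eventually (lt_mem_nhds hc)
    filter_upwards [this] with k hk
    exact hk.trans_le (hψg _ _)

lemma aux_smooth [TopologicalSpace.SeparableSpace X] (hrefl : IsReflexiveSpace X) :
    ∃ (ψ : X → ℝ) (J : X → X →L[ℝ] ℝ), (∀ x, HasFDerivAt ψ (J x) x) ∧ Continuous J ∧
      (∀ x, ‖J x‖ ≤ ‖x‖) ∧ (∀ x, ‖x‖ ^ 2 / 12 ≤ ψ x) ∧ ψ 0 = 0 ∧
      (∀ (x : ℕ → X) (z : X), (∀ φ : X →L[ℝ] ℝ, Tendsto (fun k => φ (x k)) atTop (𝓝 (φ z))) →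
          ∀ c : ℝ, c < ψ z → ∀ᶠ k in atTop, c < ψ (x k)) := by
  obtain ⟨φ, hφ⟩ := aux_dense hrefl
  obtain ⟨u, hu⟩ := TopologicalSpace.exists_dense_seq X
  have hgen : ∀ {W : Type _} [NormedAddCommGroup W] [NormedSpace ℝ W] (T : W →L[ℝ] X) (f g : X →L[ℝ] ℝ),
      ‖((1/2 : ℝ) • (f + g)).comp T‖ ≤ (‖f.comp T‖ + ‖g.comp T‖) / 2 := by
    intro W _ _ T f g
    rw [ContinuousLinearMap.smul_comp, ContinuousLinearMap.add_comp, norm_smul]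
    have := norm_add_le (f.comp T) (g.comp T)
    norm_num
    linarith
  let W : ℕ → Submodule ℝ X := fun n => ⨅ i : Fin n, LinearMap.ker (φ i : X →ₗ[ℝ] ℝ)
  let y : ℕ → X := fun n => (1 + ‖u n‖)⁻¹ • u n
  let e := Equiv.natSumNatEquivNat
  let y' : ℕ → X := fun m => Sum.elim y (fun n => - y n) (e.symm m)
  let qs : ℕ ⊕ ℕ → (X →L[ℝ] ℝ) → ℝ := Sum.elim (fun n f => ‖f.comp (W n).subtypeL‖) (fun n f => max (f (y' n)) 0)
  have hy : ∀ n, ‖y n‖ ≤ 1 := by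
    intro n
    simp only [y]
    have : 0 < 1 + ‖u n‖ := by positivity
    rw [norm_smul, norm_inv, Real.norm_eq_abs, abs_of_pos this, inv_mul_le_iff₀ this]
    linarith
  have hy' : ∀ n, ‖y' n‖ ≤ 1 := by
    intro n
    simp only [y']
    rcases e.symm n with n | n
    · exact hy n
    · simpa using hy n
  refine aux_core (fun n => qs (e.symm n)) ?_ ?_ ?_ ?_ ?_
  · intro n f
    rcases e.symm n with n | n
    · exact norm_nonneg (f.comp (W n).subtypeL)
    · exact le_max_right _ _
  · intro n f
    rcases e.symm n with n | n
    · refine ContinuousLinearMap.opNorm_le_bound _ (norm_nonneg _) fun x => ?_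
      exact f.le_opNorm x
    · exact max_le ((le_abs_self _).trans ((f.le_opNorm _).trans (mul_le_of_le_one_right (norm_nonneg _) (hy' n)))) (norm_nonneg _)
  · intro n f g
    rcases e.symm n with n | n
    · exact hgen (W n).subtypeL f g
    · have a1 := le_max_left (f (y' n)) 0
      have a2 := le_max_right (f (y' n)) 0
      have a3 := le_max_left (g (y' n)) 0
      have a4 := le_max_right (g (y' n)) 0
      have a5 : ((1/2 : ℝ) • (f + g)) (y' n) = (f (y' n) + g (y' n)) / 2 := by simp; ring
      simp only [qs, Sum.elim_inr]
      rw [a5]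
      refine max_le ?_ ?_ <;> linarith
  · intro n
    rcases e.symm n with n | n
    · exact aux_lsc (W n).subtypeL
    · exact ((WeakDual.eval_continuous (y' n)).max continuous_const).lowerSemicontinuous
  · intro f g B hB hq
    refine aux_lur φ hφ u hu f g B hB (fun n => ?_) (fun n => ?_)
    · have := hq (e (Sum.inl n))
      simpa only [Equiv.symm_apply_apply, qs, Sum.elim_inl] using this
    · have t1 := hq (e (Sum.inr (e (Sum.inl n))))
      have t2 := hq (e (Sum.inr (e (Sum.inr n))))
      simp only [Equiv.symm_apply_apply, qs, Sum.elim_inl, Sum.elim_inr, y'] at t1 t2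
      have hmax : ∀ a : ℝ, max a 0 - max (-a) 0 = a := fun a => by
        rcases le_total 0 a with h | h
        · rw [max_eq_left h, max_eq_right (by linarith)]; ring
        · rw [max_eq_right h, max_eq_left (by linarith)]; ring
      have t3 := t1.sub t2
      simp only [map_neg, hmax] at t3
      have t4 := t3.const_mul (1 + ‖u n‖)
      have hu0 : (1 + ‖u n‖) ≠ 0 := by positivity
      simpa only [y, map_smul, smul_eq_mul, mul_inv_cancel_left₀ hu0] using t4

end aux2

theorem stmt_13 {X Y : Type*} [NormedAddCommGroup X] [NormedSpace ℝ X] [CompleteSpace X]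
    [NormedAddCommGroup Y] [NormedSpace ℝ Y] [CompleteSpace Y]
    [TopologicalSpace.SeparableSpace X]
    (hrefl : IsReflexiveSpace X)
    (G : X → Y) (G' : X → X →L[ℝ] Y)
    (hGd : ∀ x, HasFDerivAt G (G' x) x) (hGc : Continuous G')
    (C : Set X) (K : Set Y)
    (hCne : C.Nonempty) (hCcl : IsClosed C) (hCcv : Convex ℝ C)
    (hKne : K.Nonempty) (hKcl : IsClosed K) (hKcv : Convex ℝ K)
    (xbar : X) (hxC : xbar ∈ C) (hxK : G xbar ∈ K) :
    ∀ v ∈ frechetNormalCone {x | x ∈ C ∧ G x ∈ K} xbar,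
      ∃ (h : X → ℝ) (h' : X → X →L[ℝ] ℝ),
        (∀ x, HasFDerivAt h (h' x) x) ∧ Continuous h' ∧ h' xbar = -v ∧
        (∀ x, x ∈ C → G x ∈ K → x ≠ xbar → h xbar < h x) ∧
        (∀ (x : ℕ → X) (z : X), WeakSeqConv x z →
          ∀ c : ℝ, c < h z → ∀ᶠ k in atTop, c < h (x k)) := by
  intro v hv
  obtain ⟨ψ, J, hψd, hJc, hJn, hψl, hψ0, hψw⟩ := aux_smooth hrefl
  have hδ : ∀ n : ℕ, ∃ δ : ℝ, 0 < δ ∧ δ ≤ 1 / ((n : ℝ) + 1) ∧ ∀ x, x ∈ C → G x ∈ K → ‖x - xbar‖ ≤ δ →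
      v (x - xbar) ≤ (1/2 : ℝ) ^ n * ‖x - xbar‖ := by
    intro n
    obtain ⟨δ, hδ, h⟩ := hv ((1/2 : ℝ) ^ n) (by positivity)
    refine ⟨min δ (1 / ((n : ℝ) + 1)), lt_min hδ (by positivity), min_le_right _ _, ?_⟩
    intro x hx1 hx2 hx3
    exact h x ⟨hx1, hx2⟩ (hx3.trans (min_le_left _ _))
  choose δ hδ0 hδ1 hδ2 using hδ
  set A : ℝ := 5 * (‖v‖ + 2) with hA
  have hA0 : 0 < A := by positivity
  set P : X → ℝ := fun y => 12 * ψ (y - xbar) with hP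
  have hPl : ∀ y, ‖y - xbar‖ ^ 2 ≤ P y := fun y => by
    have := hψl (y - xbar)
    simp only [hP]; linarith
  have hP0 : ∀ y, 0 ≤ P y := fun y => (sq_nonneg _).trans (hPl y)
  have hPpos : ∀ n y, 0 < δ n ^ 2 + P y := fun n y => by
    have := hP0 y
    have := hδ0 n
    positivity
  have hPd : ∀ y, HasFDerivAt P ((12 : ℝ) • J (y - xbar)) y := by
    intro y
    have h1 : HasFDerivAt (fun y => ψ (y - xbar)) (J (y - xbar)) y := by
      have := (hψd (y - xbar)).comp y ((hasFDerivAt_id y).sub_const xbar)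
      rw [ContinuousLinearMap.comp_id] at this
      exact this
    exact h1.const_mul 12
  have hPc : Continuous P := continuous_iff_continuousAt.2 fun y => (hPd y).continuousAt
  set Θ : ℕ → ℝ → ℝ := fun n s => A * (1/2 : ℝ) ^ n * (√(δ n ^ 2 + s) - δ n) with hΘ
  have hΘm : ∀ n s s', s ≤ s' → Θ n s ≤ Θ n s' := by
    intro n s s' hs
    simp only [hΘ]
    gcongr
  have hΘz : ∀ n, Θ n 0 = 0 := by
    intro n
    simp [hΘ, Real.sqrt_sq (hδ0 n).le]
  have hΘ0 : ∀ n s, 0 ≤ s → 0 ≤ Θ n s := by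
    intro n s hs
    have := hΘm n 0 s hs
    rwa [hΘz] at this
  have hgeo : Summable fun n : ℕ => A * (1/2 : ℝ) ^ n := summable_geometric_two.mul_left A
  have hΘs : ∀ s, 0 ≤ s → Summable fun n => Θ n s := by
    intro s hs
    refine Summable.of_nonneg_of_le (fun n => hΘ0 n s hs) (fun n => ?_) (hgeo.mul_right (√s))
    simp only [hΘ]
    have h1 : √(δ n ^ 2 + s) ≤ δ n + √s := by
      have hd := hδ0 n
      have hr := Real.sqrt_nonneg s
      refine Real.sqrt_le_iff.2 ⟨by positivity, ?_⟩
      nlinarith [Real.sq_sqrt hs]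
    gcongr
    linarith
  have hΘc : ∀ n, Continuous (Θ n) := fun n => by
    simp only [hΘ]; fun_prop
  set D : ℕ → X → X →L[ℝ] ℝ := fun n y =>
    (A * (1/2 : ℝ) ^ n) • ((1 / (2 * √(δ n ^ 2 + P y))) • ((12 : ℝ) • J (y - xbar))) with hD
  have hDd : ∀ n y, HasFDerivAt (fun y => Θ n (P y)) (D n y) y := by
    intro n y
    have h1 := (((hPd y).const_add (δ n ^ 2)).sqrt (hPpos n y).ne').sub_const (δ n)
    exact h1.const_mul (A * (1/2 : ℝ) ^ n)
  have hDc : ∀ n, Continuous (D n) := by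
    intro n
    have hne : ∀ y, 2 * √(δ n ^ 2 + P y) ≠ 0 := fun y => by
      have := Real.sqrt_pos.2 (hPpos n y)
      positivity
    have h1 : Continuous fun y => 1 / (2 * √(δ n ^ 2 + P y)) :=
      continuous_const.div (by fun_prop) hne
    have h2 : Continuous fun y => (12 : ℝ) • J (y - xbar) := by fun_prop
    have h3 : Continuous fun y => (1 / (2 * √(δ n ^ 2 + P y))) • ((12 : ℝ) • J (y - xbar)) := h1.smul h2
    have h4 : Continuous fun y => (A * (1/2 : ℝ) ^ n) • ((1 / (2 * √(δ n ^ 2 + P y))) • ((12 : ℝ) • J (y - xbar))) :=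
      Continuous.smul (f := fun _ => A * (1/2 : ℝ) ^ n) continuous_const h3
    exact h4
  have hDb : ∀ n y, ‖D n y‖ ≤ A * (1/2 : ℝ) ^ n * 6 := by
    intro n y
    have hs := Real.sqrt_pos.2 (hPpos n y)
    have h1 : ‖y - xbar‖ ≤ √(δ n ^ 2 + P y) := by
      refine Real.le_sqrt_of_sq_le ?_
      have := hPl y
      have := sq_nonneg (δ n)
      linarith
    have h2 := hJn (y - xbar)
    simp only [hD]
    rw [norm_smul, norm_smul, norm_smul, Real.norm_of_nonneg (by positivity),
      Real.norm_of_nonneg (by positivity), Real.norm_of_nonneg (by norm_num)]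
    refine mul_le_mul_of_nonneg_left ?_ (by positivity)
    rw [one_div, inv_mul_le_iff₀ (by positivity)]
    linarith
  have hPbar : P xbar = 0 := by simp [hP, hψ0]
  have hJ0 : J 0 = 0 := by
    have := hJn 0
    simpa using this
  refine ⟨fun x => -v x + ∑' n, Θ n (P x), fun x => -v + ∑' n, D n x, ?_, ?_, ?_, ?_, ?_⟩
  · intro x
    have h1 : HasFDerivAt (fun x => ∑' n, Θ n (P x)) (∑' n, D n x) x :=
      hasFDerivAt_tsum (hgeo.mul_right 6) hDd hDb (x₀ := xbar) (hΘs _ (hP0 _)) x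
    exact v.hasFDerivAt.neg.add h1
  · exact continuous_const.add (continuous_tsum hDc (hgeo.mul_right 6) hDb)
  · simp [hD, hJ0]
  · intro x hxC' hxK' hne
    have ht : 0 < ‖x - xbar‖ := norm_pos_iff.2 (sub_ne_zero.2 hne)
    set τ := ‖x - xbar‖ with hτ
    have hexn : ∃ n, δ n ≤ τ := by
      obtain ⟨n, hn⟩ := exists_nat_one_div_lt ht
      exact ⟨n, (hδ1 n).trans hn.le⟩
    classical
    obtain ⟨n, hn, hmin⟩ : ∃ n, δ n ≤ τ ∧ ∀ m < n, ¬ δ m ≤ τ :=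
      ⟨Nat.find hexn, Nat.find_spec hexn, fun m hm => Nat.find_min hexn hm⟩
    have hvb : v (x - xbar) ≤ (‖v‖ + 2) * (1/2 : ℝ) ^ n * τ := by
      rcases n with _ | n
      · have := (le_abs_self _).trans (v.le_opNorm (x - xbar))
        simp only [pow_zero, mul_one]
        nlinarith
      · have h1 := hmin n (Nat.lt_succ_self n)
        have h2 := hδ2 n x hxC' hxK' (not_le.1 h1).le
        refine h2.trans ?_
        rw [pow_succ]
        have h3 : 0 ≤ ‖v‖ * (1/2 : ℝ) ^ n * τ := by positivity
        nlinarith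
    have hterm : A * (1/2 : ℝ) ^ n * (2/5 * τ) ≤ Θ n (P x) := by
      simp only [hΘ]
      have h1 : δ n + 2/5 * τ ≤ √(δ n ^ 2 + P x) := by
        refine Real.le_sqrt_of_sq_le ?_
        have := hPl x
        have := hδ0 n
        nlinarith
      gcongr
      linarith
    have hsum : Θ n (P x) ≤ ∑' n, Θ n (P x) :=
      (hΘs _ (hP0 x)).le_tsum n fun j _ => hΘ0 j _ (hP0 x)
    have hz : ∑' n, Θ n (P xbar) = 0 := by simp [hPbar, hΘz]
    have hpos : 0 < (‖v‖ + 2) * (1/2 : ℝ) ^ n * τ := by positivity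
    have hAe : A * (1/2 : ℝ) ^ n * (2/5 * τ) = 2 * ((‖v‖ + 2) * (1/2 : ℝ) ^ n * τ) := by
      rw [hA]; ring
    have hvs : v (x - xbar) = v x - v xbar := map_sub v x xbar
    simp only [hz]
    linarith
  · intro x z hxz c hc
    have hc' : c + v z < ∑' n, Θ n (P z) := by
      simp only at hc
      linarith
    obtain ⟨F, hF⟩ := ((hΘs _ (hP0 z)).hasSum.eventually (lt_mem_nhds hc')).exists
    have hmin : Tendsto (fun k => min (P (x k)) (P z)) atTop (𝓝 (P z)) := by
      rw [tendsto_order]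
      refine ⟨fun a ha => ?_, fun a ha => Eventually.of_forall fun k => (min_le_right _ _).trans_lt ha⟩
      have h1 : a / 12 < ψ (z - xbar) := by
        simp only [hP] at ha
        linarith
      have h2 := hψw (fun k => x k - xbar) (z - xbar) (fun φ => by
        simp only [map_sub]
        exact (hxz φ).sub_const _) _ h1
      filter_upwards [h2] with k hk
      refine lt_min ?_ ha
      simp only [hP]
      linarith
    have hlim : Tendsto (fun k => -v (x k) + ∑ n ∈ F, Θ n (min (P (x k)) (P z))) atTop
        (𝓝 (-v z + ∑ n ∈ F, Θ n (P z))) :=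
      (hxz v).neg.add (tendsto_finsetSum F fun n _ => ((hΘc n).tendsto _).comp hmin)
    filter_upwards [hlim.eventually (lt_mem_nhds (show c < _ by linarith))] with k hk
    have h1 : ∑ n ∈ F, Θ n (min (P (x k)) (P z)) ≤ ∑ n ∈ F, Θ n (P (x k)) :=
      Finset.sum_le_sum fun n _ => hΘm n _ _ (min_le_left _ _)
    have h2 : ∑ n ∈ F, Θ n (P (x k)) ≤ ∑' n, Θ n (P (x k)) :=
      (hΘs _ (hP0 _)).sum_le_tsum F fun n _ => hΘ0 n _ (hP0 _)
    linarith
end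

section
/- Let X be reflexive and separable, let x̄ ∈ F be a feasible point of problem (P) which is sw-AKKT regular, and assume condition (CC) holds. Then the equalities L_F(x̄) = T^C_F(x̄) = T_F(x̄) = T^w_F(x̄) hold, where T^C, T, and T^w denote the Clarke, Bouligand, and weak tangent cones, respectively. -/
open Filter Topology MeasureTheory

theorem aux_ekeland {E : Type*} [PseudoMetricSpace E] [CompleteSpace E] (f : E → ℝ)
    (hf : Continuous f) (m : ℝ) (hm : ∀ x, m ≤ f x) (δ : ℝ) (hδ : 0 < δ) (u0 : E) :
    ∃ u, f u + δ * dist u0 u ≤ f u0 ∧ ∀ v, f u ≤ f v + δ * dist u v := by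
  have step : ∀ (n : ℕ) (u : E), ∃ w, f w + δ * dist u w ≤ f u ∧
      ∀ v, f v + δ * dist u v ≤ f u → f w ≤ f v + (1 / 2 : ℝ) ^ n := by
    intro n u
    set S : Set ℝ := f '' {v | f v + δ * dist u v ≤ f u} with hS
    have hne : S.Nonempty := ⟨f u, u, by simp, rfl⟩
    have hbd : BddBelow S := ⟨m, by rintro _ ⟨v, _, rfl⟩; exact hm v⟩
    obtain ⟨_, ⟨w, hw, rfl⟩, hlt⟩ := Real.lt_sInf_add_pos hne
      (show (0 : ℝ) < (1 / 2 : ℝ) ^ n by positivity)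
    refine ⟨w, hw, fun v hv => ?_⟩
    have := csInf_le hbd (show f v ∈ S from ⟨v, hv, rfl⟩)
    linarith
  choose g hg1 hg2 using step
  let u : ℕ → E := fun n => Nat.rec u0 (fun k w => g k w) n
  have hu0 : u 0 = u0 := rfl
  have hus : ∀ n, u (n + 1) = g n (u n) := fun n => rfl
  have h1 : ∀ n j, f (u (n + j)) + δ * dist (u n) (u (n + j)) ≤ f (u n) := by
    intro n j
    induction j with
    | zero => simp
    | succ j ih =>
      have h := hg1 (n + j) (u (n + j))
      rw [← hus] at h
      have ht := dist_triangle (u n) (u (n + j)) (u (n + j + 1))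
      have := mul_le_mul_of_nonneg_left ht hδ.le
      rw [← add_assoc]
      nlinarith
  have hanti : Antitone (fun n => f (u n)) := by
    refine antitone_nat_of_succ_le fun n => ?_
    have := h1 n 1
    have h0 : 0 ≤ δ * dist (u n) (u (n + 1)) := by positivity
    linarith
  obtain ⟨a, ha⟩ : ∃ a, Tendsto (fun n => f (u n)) atTop (𝓝 a) :=
    ⟨_, tendsto_atTop_ciInf hanti ⟨m, by rintro _ ⟨n, rfl⟩; exact hm _⟩⟩
  have hage : ∀ n, a ≤ f (u n) := fun n => hanti.le_of_tendsto ha n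
  have hcau : CauchySeq u := by
    refine cauchySeq_of_le_tendsto_0 (fun n => 2 * ((f (u n) - a) / δ)) ?_ ?_
    · have key : ∀ n k N, N ≤ n → n ≤ k → dist (u n) (u k) ≤ (f (u N) - a) / δ := by
        intro n k N h1' h2'
        rw [le_div_iff₀ hδ]
        obtain ⟨j, rfl⟩ := Nat.exists_eq_add_of_le h2'
        have e1 := h1 n j
        have e2 := hage (n + j)
        have e3 : f (u n) ≤ f (u N) := hanti h1'
        linarith
      have hnn : ∀ N, 0 ≤ (f (u N) - a) / δ := fun N =>
        div_nonneg (sub_nonneg.2 (hage N)) hδ.le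
      intro n k N hn hk
      rcases le_total n k with h | h
      · linarith [key n k N hn h, hnn N]
      · rw [dist_comm]; linarith [key k n N hk h, hnn N]
    · have : Tendsto (fun n => 2 * ((f (u n) - a) / δ)) atTop (𝓝 (2 * ((a - a) / δ))) :=
        ((ha.sub_const a).div_const δ).const_mul 2
      simpa using this
  obtain ⟨w, hw⟩ := cauchySeq_tendsto_of_complete hcau
  have hfw : Tendsto (fun n => f (u n)) atTop (𝓝 (f w)) := (hf.tendsto w).comp hw
  have hS : ∀ n, f w + δ * dist (u n) w ≤ f (u n) := by
    intro n
    have hl : Tendsto (fun j => f (u (n + j)) + δ * dist (u n) (u (n + j))) atTop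
        (𝓝 (f w + δ * dist (u n) w)) := by
      have hs : Tendsto (fun j => n + j) atTop atTop := 
        tendsto_atTop_mono (fun j => Nat.le_add_left j n) tendsto_id
      exact (hfw.comp hs).add (((tendsto_const_nhds).dist (hw.comp hs)).const_mul δ)
    exact le_of_tendsto' hl (h1 n)
  refine ⟨w, by simpa [hu0] using hS 0, ?_⟩
  intro v
  by_contra! hv
  have hvn : ∀ n, f (u (n + 1)) ≤ f v + (1 / 2 : ℝ) ^ n := by
    intro n
    rw [hus]
    apply hg2
    have := mul_le_mul_of_nonneg_left (dist_triangle (u n) w v) hδ.le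
    linarith [hS n]
  have : f w ≤ f v + 0 := by
    refine le_of_tendsto_of_tendsto' (hfw.comp (tendsto_add_atTop_nat 1)) ?_ hvn
    exact tendsto_const_nhds.add
      (tendsto_pow_atTop_nhds_zero_of_lt_one (by norm_num) (by norm_num))
  have h0 : 0 ≤ δ * dist w v := by positivity
  linarith

theorem aux_sandwich {Z : Type*} [NormedAddCommGroup Z] [NormedSpace ℝ Z] (P : Z → ℝ)
    (hPc : Continuous P) (hP : ConvexOn ℝ Set.univ P) (hP0 : P 0 = 0) (S : Set Z)
    (hS : Convex ℝ S) (h0 : (0 : Z) ∈ S) (hPS : ∀ z ∈ S, 0 ≤ P z) :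
    ∃ l : Z →L[ℝ] ℝ, (∀ z, l z ≤ P z) ∧ ∀ z ∈ S, 0 ≤ l z := by
  have hs1 : Convex ℝ {p : Z × ℝ | P p.1 < p.2} := by
    simpa using hP.convex_strict_epigraph
  have hs2 : IsOpen {p : Z × ℝ | P p.1 < p.2} :=
    isOpen_lt (hPc.comp continuous_fst) continuous_snd
  have ht : Convex ℝ (S ×ˢ Set.Iic (0 : ℝ)) := hS.prod (convex_Iic 0)
  have hd : Disjoint {p : Z × ℝ | P p.1 < p.2} (S ×ˢ Set.Iic (0 : ℝ)) := by
    rw [Set.disjoint_left]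
    rintro ⟨z, r⟩ hp ⟨hz, hr⟩
    have hp' : P z < r := hp
    have hr' : r ≤ 0 := hr
    linarith [hPS z hz]
  obtain ⟨f, u, hfs, hft⟩ := geometric_hahn_banach_open hs1 hs2 ht hd
  set β : ℝ := f (0, 1) with hβ
  have hf : ∀ z r, f (z, r) = f (z, 0) + r * β := by
    intro z r
    have : ((z, r) : Z × ℝ) = (z, 0) + r • ((0 : Z), (1 : ℝ)) := by simp
    rw [this, map_add, map_smul, smul_eq_mul]
  have hu : u ≤ 0 := by
    have := hft (0, 0) ⟨h0, by simp⟩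
    have e0 : f ((0 : Z), (0 : ℝ)) = 0 := map_zero f
    linarith
  have hβ0 : β < 0 := by
    have := hfs (0, 1) (by simp [hP0])
    linarith
  have hle : ∀ z, f (z, 0) + P z * β ≤ 0 := by
    intro z
    by_contra! hcon
    have hr : P z < P z + (f (z, 0) + P z * β) / (-β) := by
      have : 0 < (f (z, 0) + P z * β) / (-β) := div_pos hcon (by linarith)
      linarith
    have := hfs (z, _) hr
    rw [hf] at this
    have e : (f (z, 0) + P z * β) / (-β) * β = -(f (z, 0) + P z * β) := by
      have : β ≠ 0 := hβ0.ne
      field_simp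
    nlinarith
  have hu0 : 0 ≤ u := by
    by_contra! hcon
    have h2 := hfs (0, u / (2 * β)) (by
      change P 0 < u / (2 * β)
      rw [hP0]; exact div_pos_of_neg_of_neg hcon (by linarith))
    rw [hf] at h2
    have e : u / (2 * β) * β = u / 2 := by
      have : β ≠ 0 := hβ0.ne
      field_simp
    have e0 : f ((0 : Z), (0 : ℝ)) = 0 := map_zero f
    linarith
  refine ⟨(-β)⁻¹ • f.comp (ContinuousLinearMap.inl ℝ Z ℝ), ?_, ?_⟩
  · intro z
    have h := hle z
    simp only [FunLike.coe_smul, Pi.smul_apply, ContinuousLinearMap.comp_apply,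
      ContinuousLinearMap.inl_apply, smul_eq_mul]
    rw [inv_mul_le_iff₀ (by linarith)]
    nlinarith
  · intro z hz
    have h := hft (z, 0) ⟨hz, by simp⟩
    simp only [FunLike.coe_smul, Pi.smul_apply, ContinuousLinearMap.comp_apply,
      ContinuousLinearMap.inl_apply, smul_eq_mul]
    have : 0 ≤ (-β)⁻¹ := by rw [inv_nonneg]; linarith
    exact mul_nonneg this (by linarith)

theorem aux_infDist_convex {Z : Type*} [NormedAddCommGroup Z] [NormedSpace ℝ Z] (K : Set Z)
    (hK : Convex ℝ K) (hne : K.Nonempty) :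
    ConvexOn ℝ Set.univ (fun z => Metric.infDist z K) := by
  refine ⟨convex_univ, fun p _ q _ a b ha hb hab => ?_⟩
  simp only [smul_eq_mul]
  refine le_of_forall_pos_le_add fun ε hε => ?_
  obtain ⟨k1, hk1, h1⟩ := (Metric.infDist_lt_iff hne).1
    (lt_add_of_pos_right (Metric.infDist p K) hε)
  obtain ⟨k2, hk2, h2⟩ := (Metric.infDist_lt_iff hne).1
    (lt_add_of_pos_right (Metric.infDist q K) hε)
  have h3 := Metric.infDist_le_dist_of_mem (x := a • p + b • q) (hK hk1 hk2 ha hb hab)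
  have h4 : dist (a • p + b • q) (a • k1 + b • k2) ≤ a * dist p k1 + b * dist q k2 := by
    simp only [dist_eq_norm]
    calc ‖a • p + b • q - (a • k1 + b • k2)‖ = ‖a • (p - k1) + b • (q - k2)‖ := by
          congr 1; module
      _ ≤ ‖a • (p - k1)‖ + ‖b • (q - k2)‖ := norm_add_le _ _
      _ = _ := by rw [norm_smul, norm_smul, Real.norm_of_nonneg ha, Real.norm_of_nonneg hb]
  have e1 := mul_le_mul_of_nonneg_left h1.le ha
  have e2 := mul_le_mul_of_nonneg_left h2.le hb
  have e3 : a * ε + b * ε = ε := by rw [← add_mul, hab, one_mul]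
  linarith

theorem aux_P_convex {X Y : Type*} [NormedAddCommGroup X] [NormedSpace ℝ X]
    [NormedAddCommGroup Y] [NormedSpace ℝ Y] (K : Set Y)
    (hK : Convex ℝ K) (hne : K.Nonempty) (a d : X) (b : Y) (c δ n : ℝ) (hδ : 0 ≤ δ)
    (hn : 0 ≤ n) :
    ConvexOn ℝ Set.univ (fun z : X × ℝ × Y => ‖a + z.1 - z.2.1 • d‖ - ‖a‖ - c * z.2.1
      + δ * (‖z.1‖ + |z.2.1|)
      + n * (Metric.infDist (b + z.2.2) K - Metric.infDist b K)) := by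
  refine ⟨convex_univ, ?_⟩
  rintro ⟨h1, s1, y1⟩ - ⟨h2, s2, y2⟩ - α β hα hβ hαβ
  simp only [Prod.smul_mk, Prod.mk_add_mk, smul_eq_mul]
  have e1 := (convexOn_univ_norm (E := X)).2 (Set.mem_univ (a + h1 - s1 • d))
    (Set.mem_univ (a + h2 - s2 • d)) hα hβ hαβ
  have e2 := (convexOn_univ_norm (E := X)).2 (Set.mem_univ h1) (Set.mem_univ h2) hα hβ hαβ
  have e3 := (convexOn_univ_norm (E := ℝ)).2 (Set.mem_univ s1) (Set.mem_univ s2) hα hβ hαβ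
  have e4 := (aux_infDist_convex K hK hne).2 (Set.mem_univ (b + y1))
    (Set.mem_univ (b + y2)) hα hβ hαβ
  obtain rfl : β = 1 - α := by linarith
  have r1 : α • (a + h1 - s1 • d) + (1 - α) • (a + h2 - s2 • d) =
    a + (α • h1 + (1 - α) • h2) - (α * s1 + (1 - α) * s2) • d := by module
  have r4 : α • (b + y1) + (1 - α) • (b + y2) = b + (α • y1 + (1 - α) • y2) := by module
  rw [r1] at e1
  simp only [r4] at e4
  simp only [smul_eq_mul, Real.norm_eq_abs] at e1 e2 e3 e4
  have f2 := mul_le_mul_of_nonneg_left e2 hδ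
  have f3 := mul_le_mul_of_nonneg_left e3 hδ
  have f4 := mul_le_mul_of_nonneg_left e4 hn
  linarith

theorem aux_core_s15 {X Y : Type*} [NormedAddCommGroup X] [NormedSpace ℝ X]
    [NormedAddCommGroup Y] [NormedSpace ℝ Y] (C : Set X) (hC : Convex ℝ C) (K : Set Y)
    (hK : Convex ℝ K) (hne : K.Nonempty) (G : X → Y) (A : X →L[ℝ] Y) (x p d : X)
    (hG : HasFDerivAt G A x) (hx : x ∈ C) (s t c δ n : ℝ) (hs : 0 ≤ s) (hst : s < t)
    (hδ : 0 ≤ δ) (hn : 0 ≤ n)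
    (hmin : ∀ y ∈ C, ∀ σ ∈ Set.Icc 0 t,
      ‖x - p - s • d‖ - c * s + n * Metric.infDist (G x) K ≤
      ‖y - p - σ • d‖ - c * σ + n * Metric.infDist (G y) K + δ * (‖y - x‖ + |σ - s|)) :
    ∃ (l : Y →L[ℝ] ℝ) (μ : X →L[ℝ] ℝ), μ ∈ normalCone C x ∧
      (∀ y ∈ K, l (y - G x) ≤ 0) ∧ ‖l.comp A + μ‖ ≤ 1 + δ ∧
      c - δ * (‖d‖ + 1) ≤ (l.comp A + μ) d := by
  set a : X := x - p - s • d with ha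
  set b : Y := G x with hb
  set P : X × ℝ × Y → ℝ := fun z => ‖a + z.1 - z.2.1 • d‖ - ‖a‖ - c * z.2.1
      + δ * (‖z.1‖ + |z.2.1|)
      + n * (Metric.infDist (b + z.2.2) K - Metric.infDist b K) with hP
  have hPconv : ConvexOn ℝ Set.univ P := aux_P_convex K hK hne a d b c δ n hδ hn
  have hPc : Continuous P := by
    have : Continuous fun y => Metric.infDist y K := Metric.continuous_infDist_pt K
    have h2 : Continuous fun z : X × ℝ × Y => Metric.infDist (b + z.2.2) K :=
      this.comp (by fun_prop)
    simp only [hP]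
    fun_prop
  have hP0 : P 0 = 0 := by simp [hP]
  set S : Set (X × ℝ × Y) := {z | x + z.1 ∈ C ∧ (0 ≤ z.2.1 ∧ s + z.2.1 ≤ t) ∧ z.2.2 = A z.1}
    with hS
  have hSc : Convex ℝ S := by
    rintro ⟨h1, s1, y1⟩ ⟨hh1, ⟨hs1, hs1'⟩, hy1⟩ ⟨h2, s2, y2⟩ ⟨hh2, ⟨hs2, hs2'⟩, hy2⟩ α β hα hβ hαβ
    simp only at hh1 hs1 hs1' hy1 hh2 hs2 hs2' hy2
    refine ⟨?_, ⟨?_, ?_⟩, ?_⟩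
    · have := hC hh1 hh2 hα hβ hαβ
      obtain rfl : β = 1 - α := by linarith
      convert this using 1
      simp only [Prod.smul_mk, Prod.mk_add_mk]
      module
    · simp only [Prod.smul_mk, Prod.mk_add_mk, smul_eq_mul]
      positivity
    · simp only [Prod.smul_mk, Prod.mk_add_mk, smul_eq_mul]
      obtain rfl : β = 1 - α := by linarith
      nlinarith
    · simp [hy1, hy2]
  have hS0 : (0 : X × ℝ × Y) ∈ S := by
    refine ⟨by simpa using hx, ⟨by simp, by simpa using hst.le⟩, by simp⟩
  have hPS : ∀ z ∈ S, 0 ≤ P z := by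
    rintro ⟨h, σ, y⟩ ⟨hh, ⟨hσ, hσ'⟩, hy⟩
    simp only at hh hσ hσ' hy
    -- scaling
    have hsc : ∀ τ : ℝ, 0 < τ → τ ≤ 1 →
        -(n * (τ⁻¹ * ‖G (x + τ • h) - G x - A (τ • h)‖)) ≤ P (h, σ, y) := by
      intro τ hτ hτ1
      have hc : P (τ • (h, σ, y)) ≤ τ * P (h, σ, y) := by
        have := hPconv.2 (Set.mem_univ (h, σ, y)) (Set.mem_univ 0) hτ.le
          (sub_nonneg.2 hτ1) (by ring)
        simpa [hP0] using this
      have hmem : x + τ • h ∈ C := by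
        have := hC hh hx hτ.le (sub_nonneg.2 hτ1) (by ring)
        convert this using 1
        module
      have hm := hmin (x + τ • h) hmem (s + τ * σ) ⟨by positivity, by nlinarith⟩
      have hd : Metric.infDist (G (x + τ • h)) K ≤ Metric.infDist (b + τ • y) K +
          ‖G (x + τ • h) - G x - A (τ • h)‖ := by
        have := Metric.infDist_le_infDist_add_dist (s := K) (x := G (x + τ • h))
          (y := b + τ • y)
        rw [dist_eq_norm] at this
        have e : G (x + τ • h) - (b + τ • y) = G (x + τ • h) - G x - A (τ • h) := by
          rw [hy, hb, map_smul]; abel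
        rwa [e] at this
      have hd' := mul_le_mul_of_nonneg_left hd hn
      have r1 : x + τ • h - p - (s + τ * σ) • d = a + τ • h - (τ * σ) • d := by
        rw [ha]; module
      have r2 : x + τ • h - x = τ • h := by abel
      have r3 : s + τ * σ - s = τ * σ := by ring
      rw [r1, r2, r3] at hm
      have hPv : P (τ • (h, σ, y)) = ‖a + τ • h - (τ * σ) • d‖ - ‖a‖ - c * (τ * σ)
          + δ * (‖τ • h‖ + |τ * σ|)
          + n * (Metric.infDist (b + τ • y) K - Metric.infDist b K) := by
        simp [hP]
      have : -(n * ‖G (x + τ • h) - G x - A (τ • h)‖) ≤ τ * P (h, σ, y) := by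
        rw [hPv] at hc
        linarith
      have h5 := mul_le_mul_of_nonneg_left this (inv_pos.2 hτ).le
      rw [inv_mul_cancel_left₀ hτ.ne'] at h5
      linarith
    have hlim : Tendsto (fun k : ℕ => -(n * (((1 : ℝ) / ((k : ℝ) + 1))⁻¹ *
        ‖G (x + ((1 : ℝ) / ((k : ℝ) + 1)) • h) - G x - A (((1 : ℝ) / ((k : ℝ) + 1)) • h)‖)))
        atTop (𝓝 0) := by
      have ht : Tendsto (fun k : ℕ => (1 : ℝ) / ((k : ℝ) + 1)) atTop (𝓝 0) :=
        tendsto_one_div_add_atTop_nhds_zero_nat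
      have hth : Tendsto (fun k : ℕ => ((1 : ℝ) / ((k : ℝ) + 1)) • h) atTop (𝓝 0) := by
        simpa using ht.smul_const h
      have ho := (hasFDerivAt_iff_isLittleO_nhds_zero.1 hG).comp_tendsto hth
      have hO : (fun k : ℕ => ((1 : ℝ) / ((k : ℝ) + 1)) • h) =O[atTop]
          (fun k : ℕ => (1 : ℝ) / ((k : ℝ) + 1)) := by
        refine Asymptotics.IsBigO.of_bound ‖h‖ (Eventually.of_forall fun k => ?_)
        rw [norm_smul, mul_comm]
      have h6 := (ho.trans_isBigO hO).norm_left.tendsto_div_nhds_zero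
      have h7 := (h6.const_mul n).neg
      simp only [mul_zero, neg_zero] at h7
      refine h7.congr fun k => ?_
      simp only [Function.comp]
      rw [div_eq_inv_mul]
    refine le_of_tendsto' hlim fun k => hsc _ (by positivity) ?_
    rw [div_le_one (by positivity)]
    linarith [(Nat.cast_nonneg k : (0 : ℝ) ≤ k)]
  obtain ⟨l, hl1, hl2⟩ := aux_sandwich P hPc hPconv hP0 S hSc hS0 hPS
  set l1 : X →L[ℝ] ℝ := l.comp (ContinuousLinearMap.inl ℝ X (ℝ × Y)) with hl1d
  set l3 : Y →L[ℝ] ℝ := l.comp ((ContinuousLinearMap.inr ℝ X (ℝ × Y)).comp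
    (ContinuousLinearMap.inr ℝ ℝ Y)) with hl3d
  set l2 : ℝ := l (0, 1, 0) with hl2d
  have hl : ∀ h σ y, l (h, σ, y) = l1 h + σ * l2 + l3 y := by
    intro h σ y
    have : ((h, σ, y) : X × ℝ × Y) = (h, 0, 0) + σ • ((0 : X), (1 : ℝ), (0 : Y)) + (0, 0, y) := by
      simp
    rw [this, map_add, map_add, map_smul, smul_eq_mul]
    rfl
  refine ⟨l3, -l1 - l3.comp A, ⟨hx, ?_⟩, ?_, ?_, ?_⟩
  · intro z hz
    have := hl2 (z - x, 0, A (z - x)) ⟨by simpa using hz, ⟨le_rfl, by simpa using hst.le⟩, rfl⟩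
    rw [hl] at this
    simp only [FunLike.coe_sub, Pi.sub_apply, FunLike.coe_neg, Pi.neg_apply, ContinuousLinearMap.comp_apply]
    linarith
  · intro y hy
    have := hl1 (0, 0, y - b)
    rw [hl] at this
    have hz : Metric.infDist y K = 0 := Metric.infDist_zero_of_mem hy
    have hnn := mul_nonneg hn (Metric.infDist_nonneg (x := b) (s := K))
    simp [hP, hz] at this
    have e : l3 (y - b) = l3 y - l3 b := map_sub _ _ _
    linarith
  · have : l3.comp A + (-l1 - l3.comp A) = -l1 := by abel
    rw [this, norm_neg]
    have hb1 : ∀ h, l1 h ≤ (1 + δ) * ‖h‖ := by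
      intro h
      have := hl1 (h, 0, 0)
      rw [hl] at this
      simp [hP] at this
      have := norm_add_le a h
      linarith
    refine ContinuousLinearMap.opNorm_le_bound _ (by positivity) fun h => ?_
    rw [Real.norm_eq_abs, abs_le]
    have h1 := hb1 h
    have h2 := hb1 (-h)
    rw [map_neg, norm_neg] at h2
    constructor <;> linarith
  · have : l3.comp A + (-l1 - l3.comp A) = -l1 := by abel
    rw [this]
    have h1 := hl1 (d, 1, 0)
    rw [hl] at h1
    simp [hP] at h1
    have h2 := hl2 (0, t - s, 0) ⟨by simpa using hx, ⟨by simpa using hst.le, by simp⟩, by simp⟩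
    rw [hl] at h2
    simp at h2
    have h3 : 0 ≤ l2 := by
      by_contra! h
      nlinarith
    simp only [FunLike.coe_neg, Pi.neg_apply]
    linarith

theorem aux_weak_seq_compact {X : Type*} [NormedAddCommGroup X] [NormedSpace ℝ X]
    [TopologicalSpace.SeparableSpace X] (hrefl : IsReflexiveSpace X) (z : ℕ → X) (R : ℝ)
    (hz : ∀ k, ‖z k‖ ≤ R) :
    ∃ (z0 : X) (φ : ℕ → ℕ), StrictMono φ ∧ WeakSeqConv (fun k => z (φ k)) z0 := by
  set B : Set (WeakDual ℝ (StrongDual ℝ X)) :=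
    WeakDual.toStrongDual ⁻¹' Metric.closedBall (0 : StrongDual ℝ (StrongDual ℝ X)) R with hB
  have hBc : IsCompact B := WeakDual.isCompact_closedBall _ _
  have hcs : CompactSpace B := isCompact_iff_compactSpace.mp hBc
  choose g hg1 hg2 using fun n : ℕ => exists_dual_vector'' ℝ (TopologicalSpace.denseSeq X n)
  have hmet : TopologicalSpace.MetrizableSpace B := by
    refine Metric.PiNatEmbed.TopologicalSpace.MetrizableSpace.of_countable_separating
      (fun n (k : B) => (k : WeakDual ℝ (StrongDual ℝ X)) (g n))
      (fun n => (WeakDual.eval_continuous (g n)).comp continuous_subtype_val) ?_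
    intro x y hxy
    by_contra! hcon
    apply hxy
    obtain ⟨a, ha⟩ := hrefl (WeakDual.toStrongDual (x : WeakDual ℝ (StrongDual ℝ X)))
    obtain ⟨b, hb⟩ := hrefl (WeakDual.toStrongDual (y : WeakDual ℝ (StrongDual ℝ X)))
    have hga : ∀ f : StrongDual ℝ X, (x : WeakDual ℝ (StrongDual ℝ X)) f = f a := by
      intro f
      have := DFunLike.congr_fun ha f
      simpa using this.symm
    have hgb : ∀ f : StrongDual ℝ X, (y : WeakDual ℝ (StrongDual ℝ X)) f = f b := by
      intro f
      have := DFunLike.congr_fun hb f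
      simpa using this.symm
    have hab : a = b := by
      by_contra hne
      have hpos : 0 < ‖a - b‖ := norm_pos_iff.2 (sub_ne_zero.2 hne)
      obtain ⟨n, hn⟩ := (TopologicalSpace.denseRange_denseSeq X).exists_dist_lt (a - b)
        (show 0 < ‖a - b‖ / 4 by positivity)
      have h0 : g n (a - b) = 0 := by
        have := hcon n
        simp only [hga, hgb] at this
        rw [map_sub, this, sub_self]
      set w := TopologicalSpace.denseSeq X n
      rw [dist_eq_norm] at hn
      have h1 : g n w ≤ ‖w - (a - b)‖ := by
        have e : g n w = g n (w - (a - b)) := by rw [map_sub, h0, sub_zero]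
        rw [e]
        refine (le_abs_self _).trans ?_
        have := (g n).le_of_opNorm_le (hg1 n) (w - (a - b))
        simpa using this
      have h2 : g n w = ‖w‖ := by simpa using hg2 n
      have h3 : ‖a - b‖ ≤ ‖a - b - w‖ + ‖w‖ := by
        have := norm_add_le (a - b - w) w
        simpa using this
      rw [norm_sub_rev] at h1
      linarith
    apply Subtype.ext
    apply DFunLike.ext
    intro f
    rw [hga, hgb, hab]
  have hmem : ∀ k, StrongDual.toWeakDual (NormedSpace.inclusionInDoubleDual ℝ X (z k)) ∈ B := by
    intro k
    have h : NormedSpace.inclusionInDoubleDual ℝ X (z k) ∈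
        Metric.closedBall (0 : StrongDual ℝ (StrongDual ℝ X)) R := by
      exact (mem_closedBall_zero_iff (E := StrongDual ℝ (StrongDual ℝ X))).2
        ((NormedSpace.double_dual_bound ℝ X (z k)).trans (hz k))
    exact h
  obtain ⟨w, φ, hφ, hw⟩ := CompactSpace.tendsto_subseq
    (fun k => (⟨_, hmem k⟩ : B))
  obtain ⟨a, ha⟩ := hrefl (WeakDual.toStrongDual (w : WeakDual ℝ (StrongDual ℝ X)))
  refine ⟨a, φ, hφ, fun f => ?_⟩
  have h1 := ((WeakDual.eval_continuous f).comp (continuous_subtype_val (p := (· ∈ B)))).tendsto w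
  have h2 := h1.comp hw
  have h3 := DFunLike.congr_fun ha f
  have h4 : (w : WeakDual ℝ (StrongDual ℝ X)) f = f a := by simpa using h3.symm
  simp only [Function.comp_def, h4] at h2
  exact h2

theorem aux_weak_closed {X : Type*} [NormedAddCommGroup X] [NormedSpace ℝ X] (C : Set X)
    (hCcl : IsClosed C) (hC : Convex ℝ C) (z : ℕ → X) (z0 : X) (hz : ∀ k, z k ∈ C)
    (hw : WeakSeqConv z z0) : z0 ∈ C := by
  by_contra h
  obtain ⟨f, u, h1, h2⟩ := geometric_hahn_banach_point_closed hC hCcl h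
  have := ge_of_tendsto' (hw f) (fun k => (h2 _ (hz k)).le)
  linarith

theorem aux_penalty {X Y : Type*} [NormedAddCommGroup X] [NormedSpace ℝ X]
    [NormedAddCommGroup Y] [NormedSpace ℝ Y]
    [TopologicalSpace.SeparableSpace X] (hrefl : IsReflexiveSpace X)
    (G : X → Y) (C : Set X) (K : Set Y) (hCcl : IsClosed C) (hCcv : Convex ℝ C)
    (hCC : CondCC G C K) (q : X) (ρ : ℝ) (hρ : 0 < ρ)
    (hF : ∀ z ∈ C, G z ∈ K → 2 * ρ ≤ ‖z - q‖) :
    ∃ n : ℕ, ∀ z ∈ C, ρ ≤ ‖z - q‖ + n * Metric.infDist (G z) K := by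
  by_contra! hcon
  choose z hzC hz using hcon
  have hnn : ∀ k : ℕ, 0 ≤ (k : ℝ) * Metric.infDist (G (z k)) K := fun k =>
    mul_nonneg (Nat.cast_nonneg k) Metric.infDist_nonneg
  have hb : ∀ k, ‖z k - q‖ ≤ ρ := fun k => by linarith [hz k, hnn k]
  have hb2 : ∀ k, ‖z k‖ ≤ ρ + ‖q‖ := by
    intro k
    have := norm_add_le (z k - q) q
    rw [sub_add_cancel] at this
    linarith [hb k]
  obtain ⟨z0, φ, hφ, hw⟩ := aux_weak_seq_compact hrefl z _ hb2
  have hz0 : z0 ∈ C := aux_weak_closed C hCcl hCcv _ z0 (fun k => hzC (φ k)) hw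
  have hd : Tendsto (fun k => Metric.infDist (G (z k)) K) atTop (𝓝 0) := by
    refine squeeze_zero' (Eventually.of_forall fun k => Metric.infDist_nonneg)
      ?_ (tendsto_const_div_atTop_nhds_zero_nat ρ)
    filter_upwards [eventually_gt_atTop 0] with k hk
    have hk' : (0 : ℝ) < k := Nat.cast_pos.2 hk
    rw [le_div_iff₀ hk']
    linarith [hz k, norm_nonneg (z k - q)]
  have hK0 : G z0 ∈ K := hCC _ z0 (fun k => hzC (φ k)) hz0 hw (hd.comp hφ.tendsto_atTop)
  have h2 := hF z0 hz0 hK0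
  obtain ⟨g, hg1, hg2⟩ := exists_dual_vector'' ℝ (z0 - q)
  have hl : Tendsto (fun k => g (z (φ k)) - g q) atTop (𝓝 (g z0 - g q)) :=
    (hw g).sub_const _
  have h3 : g z0 - g q ≤ ρ := by
    refine le_of_tendsto' hl fun k => ?_
    rw [← map_sub]
    refine (le_abs_self _).trans ?_
    have := g.le_of_opNorm_le hg1 (z (φ k) - q)
    rw [one_mul, Real.norm_eq_abs] at this
    exact this.trans (hb _)
  rw [← map_sub, hg2] at h3
  simp at h3
  linarith

theorem aux_step {X Y : Type*} [NormedAddCommGroup X] [NormedSpace ℝ X] [CompleteSpace X]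
    [NormedAddCommGroup Y] [NormedSpace ℝ Y]
    [TopologicalSpace.SeparableSpace X] (hrefl : IsReflexiveSpace X)
    (G : X → Y) (G' : X → X →L[ℝ] Y)
    (hGd : ∀ x, HasFDerivAt G (G' x) x)
    (C : Set X) (K : Set Y) (hCcl : IsClosed C) (hCcv : Convex ℝ C)
    (hKne : K.Nonempty) (hKcv : Convex ℝ K)
    (hCC : CondCC G C K) (x0 d : X) (hxC : x0 ∈ C) (hxK : G x0 ∈ K) (t ε : ℝ) (ht : 0 < t)
    (hε : 0 < ε) (hF : ∀ z ∈ C, G z ∈ K → ε * t ≤ ‖z - (x0 + t • d)‖) :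
    ∃ (x : X) (v : X →L[ℝ] ℝ), v ∈ Mset G G' C K x 0 ∧ ‖v‖ ≤ 2 ∧ ε / 8 ≤ v d ∧
      ‖x - x0‖ ≤ t * (ε / 4 + ‖d‖) := by
  obtain ⟨n, hn⟩ := aux_penalty hrefl G C K hCcl hCcv hCC (x0 + t • d) (ε * t / 2)
    (by positivity) (fun z h1 h2 => by linarith [hF z h1 h2])
  set δ : ℝ := min 1 (ε / (8 * (‖d‖ + 1))) with hδ
  have hδ0 : 0 < δ := lt_min one_pos (by positivity)
  have hδ1 : δ ≤ 1 := min_le_left _ _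
  have hδ2 : δ * (‖d‖ + 1) ≤ ε / 8 := by
    have h := mul_le_mul_of_nonneg_right (min_le_right 1 (ε / (8 * (‖d‖ + 1))))
      (show 0 ≤ ‖d‖ + 1 by positivity)
    refine h.trans (le_of_eq ?_)
    field_simp
  set S : Set (X × ℝ) := C ×ˢ Set.Icc 0 t with hS
  have hScl : IsClosed S := hCcl.prod isClosed_Icc
  have : CompleteSpace S := hScl.completeSpace_coe
  set Ψ : X × ℝ → ℝ := fun p => ‖p.1 - x0 - p.2 • d‖ - ε / 4 * p.2
    + n * Metric.infDist (G p.1) K with hΨ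
  have hGcont : Continuous G := continuous_iff_continuousAt.2 fun x => (hGd x).continuousAt
  have hΨc : Continuous Ψ := by
    have : Continuous fun y => Metric.infDist y K := Metric.continuous_infDist_pt K
    have h2 : Continuous fun z : X × ℝ => Metric.infDist (G z.1) K :=
      this.comp (hGcont.comp continuous_fst)
    simp only [hΨ]
    fun_prop
  have hnn : ∀ y, 0 ≤ (n : ℝ) * Metric.infDist (G y) K := fun k =>
    mul_nonneg (Nat.cast_nonneg n) Metric.infDist_nonneg
  obtain ⟨⟨⟨x, s⟩, hxs⟩, h1, h2⟩ := aux_ekeland (fun p : S => Ψ p)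
    (hΨc.comp continuous_subtype_val)
    (-(ε / 4 * t)) (by
      rintro ⟨⟨y, σ⟩, hy, hσ⟩
      simp only [Set.mem_Icc] at hσ
      simp only [hΨ]
      have := norm_nonneg (y - x0 - σ • d)
      have := hnn y
      have := mul_le_mul_of_nonneg_left hσ.2 (show 0 ≤ ε / 4 by positivity)
      linarith) δ hδ0 ⟨(x0, 0), hxC, by simp [ht.le]⟩
  obtain ⟨hx, hs⟩ := hxs
  simp only [Set.mem_Icc] at hx hs
  have hΨ0 : Ψ (x0, 0) = 0 := by simp [hΨ, Metric.infDist_zero_of_mem hxK]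
  have hle : Ψ (x, s) ≤ 0 := by
    simp only [hΨ0] at h1
    refine le_trans ?_ h1
    exact le_add_of_nonneg_right (by positivity)
  have hle' : ‖x - x0 - s • d‖ - ε / 4 * s + n * Metric.infDist (G x) K ≤ 0 := hle
  have hst : s < t := by
    refine lt_of_le_of_ne hs.2 ?_
    rintro rfl
    have := hn x hx
    rw [← sub_sub] at this
    have : 0 < ε * s := by positivity
    linarith
  have hmin : ∀ y ∈ C, ∀ σ ∈ Set.Icc 0 t,
      ‖x - x0 - s • d‖ - ε / 4 * s + n * Metric.infDist (G x) K ≤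
      ‖y - x0 - σ • d‖ - ε / 4 * σ + n * Metric.infDist (G y) K
        + δ * (‖y - x‖ + |σ - s|) := by
    intro y hy σ hσ
    have := h2 ⟨(y, σ), hy, hσ⟩
    simp only [hΨ] at this
    refine this.trans ?_
    gcongr
    rw [Subtype.dist_eq, Prod.dist_eq]
    refine max_le ?_ ?_
    · rw [dist_comm, dist_eq_norm]
      exact le_add_of_nonneg_right (abs_nonneg _)
    · rw [dist_comm, Real.dist_eq]
      exact le_add_of_nonneg_left (norm_nonneg _)
  obtain ⟨l, μ, hμ, hl, hv, hvd⟩ := aux_core_s15 C hCcv K hKcv hKne G (G' x) x x0 d (hGd x) hx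
    s t (ε / 4) δ n hs.1 hst hδ0.le (Nat.cast_nonneg n) hmin
  refine ⟨x, l.comp (G' x) + μ, ⟨l, μ, hμ, hl, rfl⟩, by linarith, by linarith, ?_⟩
  have e1 := norm_add_le (x - x0 - s • d) (s • d)
  rw [sub_add_cancel, norm_smul, Real.norm_of_nonneg hs.1] at e1
  have e2 := hnn x
  have e3 := mul_le_mul_of_nonneg_right hs.2 (show 0 ≤ ε / 4 + ‖d‖ by positivity)
  linarith

theorem aux_tangent_of_polar {Z : Type*} [NormedAddCommGroup Z] [NormedSpace ℝ Z] (S : Set Z)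
    (hS : Convex ℝ S) (y d : Z) (hy : y ∈ S)
    (h : ∀ φ : Z →L[ℝ] ℝ, (∀ z ∈ S, φ (z - y) ≤ 0) → φ d ≤ 0) : d ∈ tangentCone S y := by
  have hRc : Convex ℝ (radialCone S y) := by
    rintro _ ⟨α, hα, z, hz, rfl⟩ _ ⟨β, hβ, w, hw, rfl⟩ a b ha hb hab
    rcases eq_or_lt_of_le (show 0 ≤ a * α + b * β by positivity) with h0 | h0
    · have h1 : a * α = 0 := by nlinarith [mul_nonneg ha hα, mul_nonneg hb hβ]
      have h2 : b * β = 0 := by nlinarith [mul_nonneg ha hα, mul_nonneg hb hβ]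
      refine ⟨0, le_rfl, y, hy, ?_⟩
      rw [smul_smul, smul_smul, h1, h2]; simp
    · refine ⟨a * α + b * β, h0.le, (a * α / (a * α + b * β)) • z + (b * β / (a * α + b * β)) • w,
        hS hz hw (by positivity) (by positivity) (by field_simp), ?_⟩
      rw [smul_sub (a * α + b * β), smul_add (a * α + b * β), smul_smul (a * α + b * β),
        smul_smul (a * α + b * β), mul_div_cancel₀ _ h0.ne', mul_div_cancel₀ _ h0.ne']
      module
  have hdc : d ∈ closure (radialCone S y) := by
    by_contra hd
    obtain ⟨f, u, h1, h2⟩ := geometric_hahn_banach_closed_point hRc.closure isClosed_closure hd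
    have hu : 0 < u := by
      have := h1 0 (subset_closure ⟨0, le_rfl, y, hy, by simp⟩)
      simpa using this
    have := h f fun z hz => by
      by_contra! hpos
      have h3 := h1 ((u / f (z - y)) • (z - y))
        (subset_closure ⟨_, by positivity, z, hz, rfl⟩)
      rw [map_smul, smul_eq_mul, div_mul_cancel₀ _ hpos.ne'] at h3
      exact lt_irrefl _ h3
    linarith
  obtain ⟨q, hq, hqd⟩ := mem_closure_iff_seq_limit.1 hdc
  choose α hα z hz hqz using hq
  set T : ℕ → ℝ := fun k => (k : ℝ) + 1 + ∑ i ∈ Finset.range (k + 1), α i with hT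
  have hsum : ∀ k, 0 ≤ ∑ i ∈ Finset.range (k + 1), α i := fun k =>
    Finset.sum_nonneg fun i _ => hα i
  have hTpos : ∀ k, 0 < T k := fun k => by
    have := hsum k
    simp only [hT]; positivity
  have hTα : ∀ k, α k ≤ T k := fun k => by
    have := Finset.single_le_sum (f := α) (fun i _ => hα i) (Finset.self_mem_range_succ k)
    simp only [hT]
    have : (0 : ℝ) ≤ k := Nat.cast_nonneg k
    linarith
  have hTm : Monotone T := by
    refine monotone_nat_of_le_succ fun k => ?_
    simp only [hT]
    rw [Finset.sum_range_succ _ (k + 1)]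
    push_cast
    linarith [hα (k + 1)]
  have hTt : Tendsto (fun k => (T k)⁻¹) atTop (𝓝 0) := by
    refine tendsto_inv_atTop_zero.comp (tendsto_atTop_mono (fun k => ?_)
      tendsto_natCast_atTop_atTop)
    simp only [hT]
    linarith [hsum k]
  have hxe : ∀ k, (y + (T k)⁻¹ • q k) - y = (T k)⁻¹ • q k := fun k => by abel
  refine ⟨fun k => y + (T k)⁻¹ • q k, fun k => (T k)⁻¹, fun k => ?_, fun k => inv_pos.2 (hTpos k),
    fun i j hij => inv_anti₀ (hTpos i) (hTm hij), hTt, ?_, ?_⟩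
  · have h1 : (T k)⁻¹ * α k ≤ 1 := by
      rw [inv_mul_le_iff₀ (hTpos k)]; simpa using hTα k
    have h0 : 0 ≤ (T k)⁻¹ * α k := mul_nonneg (inv_pos.2 (hTpos k)).le (hα k)
    have := hS (hz k) hy h0 (sub_nonneg.2 h1) (by ring)
    convert this using 1
    simp only [hqz, smul_smul]
    module
  · have := (hTt.smul hqd).const_add y
    simpa using this
  · refine hqd.congr fun k => ?_
    rw [hxe, smul_smul, inv_inv, mul_inv_cancel₀ (hTpos k).ne', one_smul]

theorem aux_polar_tangent {Z : Type*} [NormedAddCommGroup Z] [NormedSpace ℝ Z] (S : Set Z)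
    (y d : Z) (hd : d ∈ tangentCone S y) (φ : Z →L[ℝ] ℝ)
    (h : ∀ z ∈ S, φ (z - y) ≤ 0) : φ d ≤ 0 := by
  obtain ⟨x, t, hx, ht, -, -, -, hl⟩ := hd
  refine le_of_tendsto' ((φ.continuous.tendsto d).comp hl) fun k => ?_
  simp only [Function.comp, map_smul, smul_eq_mul]
  exact mul_nonpos_of_nonneg_of_nonpos (inv_pos.2 (ht k)).le (h _ (hx k))

theorem aux_weak_bounded {X : Type*} [NormedAddCommGroup X] [NormedSpace ℝ X]
    (z : ℕ → X) (z0 : X) (hw : WeakSeqConv z z0) : ∃ R, ∀ k, ‖z k‖ ≤ R := by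
  obtain ⟨R, hR⟩ := banach_steinhaus
    (g := fun k => NormedSpace.inclusionInDoubleDual ℝ X (z k)) (fun f => by
      obtain ⟨M, hM⟩ := (hw f).norm.bddAbove_range
      exact ⟨M, fun k => by simpa using hM ⟨k, rfl⟩⟩)
  refine ⟨R, fun k => ?_⟩
  have := hR k
  rwa [show ‖NormedSpace.inclusionInDoubleDual ℝ X (z k)‖ = ‖z k‖ from
    (NormedSpace.inclusionInDoubleDualLi ℝ (E := X)).norm_map (z k)] at this

theorem aux_weak_sub_lin {X Y : Type*} [NormedAddCommGroup X] [NormedSpace ℝ X]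
    [NormedAddCommGroup Y] [NormedSpace ℝ Y]
    (G : X → Y) (G' : X → X →L[ℝ] Y)
    (hGd : ∀ x, HasFDerivAt G (G' x) x)
    (C : Set X) (K : Set Y) (hCcv : Convex ℝ C) (hKcv : Convex ℝ K)
    (xbar : X) (hxC : xbar ∈ C) (hxK : G xbar ∈ K) (d : X)
    (hd : d ∈ weakTangentCone {x | x ∈ C ∧ G x ∈ K} xbar) :
    d ∈ tangentCone C xbar ∧ G' xbar d ∈ tangentCone K (G xbar) := by
  obtain ⟨x, t, hx, ht, hta, ht0, hxl, hw⟩ := hd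
  constructor
  · refine aux_tangent_of_polar C hCcv _ _ hxC fun φ hφ => ?_
    refine le_of_tendsto' (hw φ) fun k => ?_
    simp only [map_smul, smul_eq_mul]
    exact mul_nonpos_of_nonneg_of_nonpos (inv_pos.2 (ht k)).le (hφ _ (hx k).1)
  · refine aux_tangent_of_polar K hKcv _ _ hxK fun φ hφ => ?_
    obtain ⟨R, hR⟩ := aux_weak_bounded _ _ hw
    have ho := (hGd xbar).isLittleO.comp_tendsto hxl
    have hO : (fun k => x k - xbar) =O[atTop] t := by
      refine Asymptotics.IsBigO.of_bound R (Eventually.of_forall fun k => ?_)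
      have := hR k
      rw [norm_smul, norm_inv, inv_mul_le_iff₀ (norm_pos_iff.2 (ht k).ne')] at this
      linarith
    have h1 : (fun k => φ (G (x k) - G xbar - G' xbar (x k - xbar))) =o[atTop] t :=
      (φ.isBigO_comp _ _).trans_isLittleO (ho.trans_isBigO hO)
    have h2 := h1.tendsto_div_nhds_zero
    have h3 := h2.add (hw (φ.comp (G' xbar)))
    rw [zero_add] at h3
    refine le_of_tendsto' h3 fun k => ?_
    have e : φ (G (x k) - G xbar - G' xbar (x k - xbar)) / t k +
        (φ.comp (G' xbar)) ((t k)⁻¹ • (x k - xbar)) = (t k)⁻¹ * φ (G (x k) - G xbar) := by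
      rw [map_smul, map_sub φ (G (x k) - G xbar), ContinuousLinearMap.comp_apply, smul_eq_mul]
      ring
    rw [e]
    exact mul_nonpos_of_nonneg_of_nonpos (inv_pos.2 (ht k)).le (hφ _ (hx k).2)

theorem aux_lin_sub_clarke {X Y : Type*} [NormedAddCommGroup X] [NormedSpace ℝ X] [CompleteSpace X]
    [NormedAddCommGroup Y] [NormedSpace ℝ Y]
    [TopologicalSpace.SeparableSpace X] (hrefl : IsReflexiveSpace X)
    (G : X → Y) (G' : X → X →L[ℝ] Y)
    (hGd : ∀ x, HasFDerivAt G (G' x) x)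
    (C : Set X) (K : Set Y) (hCcl : IsClosed C) (hCcv : Convex ℝ C)
    (hKne : K.Nonempty) (hKcv : Convex ℝ K)
    (xbar : X) (hxC : xbar ∈ C) (hxK : G xbar ∈ K)
    (hreg : swAKKTRegular G G' C K xbar)
    (hCC : CondCC G C K) (d : X) (hd1 : d ∈ tangentCone C xbar)
    (hd2 : G' xbar d ∈ tangentCone K (G xbar)) :
    d ∈ clarkeTangentCone {x | x ∈ C ∧ G x ∈ K} xbar := by
  set F : Set X := {x | x ∈ C ∧ G x ∈ K} with hFdef
  have hFne : F.Nonempty := ⟨xbar, hxC, hxK⟩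
  intro x t hx hxl ht hta ht0
  by_cases hlim : Tendsto (fun k => (t k)⁻¹ * Metric.infDist (x k + t k • d) F) atTop (𝓝 0)
  · have hex : ∀ k, ∃ z ∈ F, dist (x k + t k • d) z <
        Metric.infDist (x k + t k • d) F + t k * (1 / ((k : ℝ) + 1)) := fun k =>
      (Metric.infDist_lt_iff hFne).1 (lt_add_of_pos_right _ (mul_pos (ht k) (by positivity)))
    choose z hz hzd using hex
    refine ⟨fun k => (t k)⁻¹ • (z k - x k), ?_, fun k => ?_⟩
    · rw [tendsto_iff_norm_sub_tendsto_zero]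
      have hb := hlim.add (tendsto_one_div_add_atTop_nhds_zero_nat (𝕜 := ℝ))
      rw [add_zero] at hb
      refine squeeze_zero (fun k => norm_nonneg _) (fun k => ?_) hb
      have e : (t k)⁻¹ • (z k - x k) - d = (t k)⁻¹ • (z k - (x k + t k • d)) := by
        rw [← sub_sub, smul_sub _ (z k - x k), smul_smul, inv_mul_cancel₀ (ht k).ne', one_smul]
      rw [e, norm_smul, norm_inv, Real.norm_of_nonneg (ht k).le, inv_mul_le_iff₀ (ht k), mul_add,
        mul_inv_cancel_left₀ (ht k).ne', ← dist_eq_norm, dist_comm]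
      exact (hzd k).le
    · rw [smul_smul, mul_inv_cancel₀ (ht k).ne', one_smul, add_sub_cancel]
      exact hz k
  · exfalso
    rw [Metric.tendsto_atTop] at hlim
    push Not at hlim
    obtain ⟨ε, hε, hfr⟩ := hlim
    obtain ⟨φ, hφ, hφε⟩ := extraction_of_frequently_atTop (frequently_atTop.2 hfr)
    have hstep : ∀ k, ∃ (w : X) (v : X →L[ℝ] ℝ), v ∈ Mset G G' C K w 0 ∧ ‖v‖ ≤ 2 ∧
        ε / 8 ≤ v d ∧ ‖w - x (φ k)‖ ≤ t (φ k) * (ε / 4 + ‖d‖) := by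
      intro k
      refine aux_step hrefl G G' hGd C K hCcl hCcv hKne hKcv hCC (x (φ k)) d (hx _).1 (hx _).2
        (t (φ k)) ε (ht _) hε fun z hz1 hz2 => ?_
      have h1 := hφε k
      rw [Real.dist_eq, sub_zero, abs_of_nonneg
        (mul_nonneg (inv_pos.2 (ht _)).le Metric.infDist_nonneg), inv_mul_eq_div,
        le_div_iff₀ (ht _)] at h1
      have h2 := Metric.infDist_le_dist_of_mem (x := x (φ k) + t (φ k) • d)
        (show z ∈ F from ⟨hz1, hz2⟩)
      rw [dist_comm, dist_eq_norm] at h2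
      exact h1.trans h2
    choose w v hv hvn hvd hwx using hstep
    have hw : Tendsto w atTop (𝓝 xbar) := by
      have h1 : Tendsto (fun k => w k - x (φ k)) atTop (𝓝 0) := by
        refine squeeze_zero_norm hwx ?_
        have := (ht0.comp hφ.tendsto_atTop).mul_const (ε / 4 + ‖d‖)
        simpa using this
      have h2 := h1.add (hxl.comp hφ.tendsto_atTop)
      simpa using h2
    obtain ⟨v0, -, ψ, hψ, hv0⟩ := WeakDual.isSeqCompact_closedBall ℝ X (0 : StrongDual ℝ X) 2
      (x := fun k => StrongDual.toWeakDual (v k)) (fun k => by simpa using hvn k)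
    have hconv : WeakStarSeqConv (fun k => v (ψ k)) (WeakDual.toStrongDual v0) := fun z =>
      ((WeakDual.eval_continuous z).tendsto v0).comp hv0
    obtain ⟨l, μ, hμ, hl, he⟩ := hreg (WeakDual.toStrongDual v0) (fun k => w (ψ k)) (fun _ => 0)
      (fun k => v (ψ k))
      (hw.comp hψ.tendsto_atTop) ⟨fun _ => le_rfl, antitone_const, tendsto_const_nhds⟩ hconv
      (fun k => hv (ψ k))
    have h1 : ε / 8 ≤ (WeakDual.toStrongDual v0) d := ge_of_tendsto' (hconv d) fun k => hvd _
    have h2 := aux_polar_tangent C xbar d hd1 μ hμ.2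
    have h3 := aux_polar_tangent K (G xbar) (G' xbar d) hd2 l hl
    rw [he] at h1
    simp only [FunLike.coe_add, Pi.add_apply, ContinuousLinearMap.comp_apply] at h1
    linarith

theorem aux_clarke_sub {X : Type*} [NormedAddCommGroup X] [NormedSpace ℝ X] (F : Set X)
    (xbar : X) (hx : xbar ∈ F) : clarkeTangentCone F xbar ⊆ tangentCone F xbar := by
  intro d hd
  have ht0 : Tendsto (fun k : ℕ => 1 / ((k : ℝ) + 1)) atTop (𝓝 0) :=
    tendsto_one_div_add_atTop_nhds_zero_nat
  have hta : Antitone (fun k : ℕ => 1 / ((k : ℝ) + 1)) := fun i j hij =>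
    Nat.one_div_le_one_div hij
  have htp : ∀ k : ℕ, 0 < 1 / ((k : ℝ) + 1) := fun k => Nat.one_div_pos_of_nat
  obtain ⟨dk, hdk, hm⟩ := hd (fun _ => xbar) (fun k => 1 / ((k : ℝ) + 1)) (fun _ => hx)
    tendsto_const_nhds htp hta ht0
  refine ⟨_, _, hm, htp, hta, ht0, ?_, ?_⟩
  · simpa using (ht0.smul hdk).const_add xbar
  · refine hdk.congr fun k => ?_
    rw [add_sub_cancel_left, smul_smul, inv_mul_cancel₀ (htp k).ne', one_smul]

theorem aux_tangent_sub_weak {X : Type*} [NormedAddCommGroup X] [NormedSpace ℝ X] (F : Set X)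
    (xbar : X) : tangentCone F xbar ⊆ weakTangentCone F xbar := by
  rintro d ⟨x, t, h1, h2, h3, h4, h5, h6⟩
  exact ⟨x, t, h1, h2, h3, h4, h5, fun φ => (φ.continuous.tendsto d).comp h6⟩

theorem stmt_15 {X Y : Type*} [NormedAddCommGroup X] [NormedSpace ℝ X] [CompleteSpace X]
    [NormedAddCommGroup Y] [NormedSpace ℝ Y] [CompleteSpace Y]
    [TopologicalSpace.SeparableSpace X]
    (hrefl : IsReflexiveSpace X)
    (G : X → Y) (G' : X → X →L[ℝ] Y)
    (hGd : ∀ x, HasFDerivAt G (G' x) x) (hGc : Continuous G')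
    (C : Set X) (K : Set Y)
    (hCne : C.Nonempty) (hCcl : IsClosed C) (hCcv : Convex ℝ C)
    (hKne : K.Nonempty) (hKcl : IsClosed K) (hKcv : Convex ℝ K)
    (xbar : X) (hxC : xbar ∈ C) (hxK : G xbar ∈ K)
    (hreg : swAKKTRegular G G' C K xbar)
    (hCC : CondCC G C K) :
    {d | d ∈ tangentCone C xbar ∧ G' xbar d ∈ tangentCone K (G xbar)} =
      clarkeTangentCone {x | x ∈ C ∧ G x ∈ K} xbar ∧
    clarkeTangentCone {x | x ∈ C ∧ G x ∈ K} xbar =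
      tangentCone {x | x ∈ C ∧ G x ∈ K} xbar ∧
    tangentCone {x | x ∈ C ∧ G x ∈ K} xbar =
      weakTangentCone {x | x ∈ C ∧ G x ∈ K} xbar := by
  have h1 := aux_clarke_sub {x | x ∈ C ∧ G x ∈ K} xbar ⟨hxC, hxK⟩
  have h2 := aux_tangent_sub_weak {x | x ∈ C ∧ G x ∈ K} xbar
  have h3 := aux_weak_sub_lin G G' hGd C K hCcv hKcv xbar hxC hxK
  have h4 := aux_lin_sub_clarke hrefl G G' hGd C K hCcl hCcv hKne hKcv xbar hxC hxK hreg hCC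
  refine ⟨?_, ?_, ?_⟩
  · exact Set.Subset.antisymm (fun d hd => h4 d hd.1 hd.2) (fun d hd => h3 d (h2 (h1 hd)))
  · exact Set.Subset.antisymm h1
      (fun d hd => h4 d (h3 d (h2 hd)).1 (h3 d (h2 hd)).2)
  · exact Set.Subset.antisymm h2
      (fun d hd => h1 (h4 d (h3 d hd).1 (h3 d hd).2))
end

section
/- Let X be a reflexive real Banach space, Y a real Banach space, A ∈ L(X,Y) a bounded linear operator with closed range, and b ∈ Y. Consider problem (P) with C = X, K = {0}, and G(x) = Ax − b, i.e., the affine constraint Ax = b. Then for every feasible point x̄ (i.e., A x̄ = b) one has M(x̄, 0) = A*(Y*), the inclusion M(x, r) ⊂ M(x̄, 0) holds for all x ∈ X and r ≥ 0, and x̄ is w-AKKT regular. -/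
open Filter Topology MeasureTheory

theorem factor_of_closed_range {X Y : Type*} [NormedAddCommGroup X] [NormedSpace ℝ X]
    [CompleteSpace X] [NormedAddCommGroup Y] [NormedSpace ℝ Y] [CompleteSpace Y]
    (A : X →L[ℝ] Y) (hrange : IsClosed (Set.range A)) (v : X →L[ℝ] ℝ)
    (hv : ∀ z, A z = 0 → v z = 0) : ∃ l : Y →L[ℝ] ℝ, v = l.comp A := by
  let R : Submodule ℝ Y := LinearMap.range (A : X →ₗ[ℝ] Y)
  have hR : IsClosed (R : Set Y) := hrange
  haveI : CompleteSpace R := hR.completeSpace_coe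
  let f : X →L[ℝ] R := A.codRestrict R (fun x => ⟨x, rfl⟩)
  have hf : Function.Surjective f := by
    rintro ⟨y, x, rfl⟩
    exact ⟨x, rfl⟩
  have hfA : ∀ x, ((f x : R) : Y) = A x := fun x => rfl
  obtain ⟨D, -, hD⟩ := f.exists_preimage_norm_le hf
  choose s hs hsn using hD
  have hker : ∀ x x', f x = f x' → v x = v x' := by
    intro x x' h
    have h1 : A (x - x') = 0 := by
      rw [map_sub, ← hfA, ← hfA, h, sub_self]
    have h2 := hv _ h1
    rw [map_sub] at h2
    linarith
  let g₀ : R →ₗ[ℝ] ℝ :=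
    { toFun := fun y => v (s y)
      map_add' := fun y z => by
        rw [← map_add]
        apply hker
        rw [map_add, hs, hs, hs]
      map_smul' := fun c y => by
        rw [RingHom.id_apply, ← map_smul]
        apply hker
        rw [map_smul, hs, hs] }
  let g : R →L[ℝ] ℝ := g₀.mkContinuous (‖v‖ * D) (fun y => by
    calc ‖v (s y)‖ ≤ ‖v‖ * ‖s y‖ := v.le_opNorm _
      _ ≤ ‖v‖ * (D * ‖y‖) := by gcongr; exact hsn y
      _ = ‖v‖ * D * ‖y‖ := by ring)
  obtain ⟨l, hl, -⟩ := exists_extension_norm_eq R g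
  refine ⟨l, ?_⟩
  ext x
  have h3 : l (A x) = v (s (f x)) := hl (f x)
  rw [ContinuousLinearMap.comp_apply, h3]
  exact hker _ _ (hs _).symm

theorem factor_of_mem_Mset {X Y : Type*} [NormedAddCommGroup X] [NormedSpace ℝ X]
    [NormedAddCommGroup Y] [NormedSpace ℝ Y]
    (A : X →L[ℝ] Y) (b : Y) (x : X) (r : ℝ) (v : X →L[ℝ] ℝ)
    (hv : v ∈ Mset (fun z => A z - b) (fun _ => A) Set.univ ({0} : Set Y) x r) :
    ∃ l : Y →L[ℝ] ℝ, v = l.comp A := by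
  obtain ⟨l, μ, ⟨-, hμ⟩, -, rfl⟩ := hv
  refine ⟨l, ?_⟩
  have : μ = 0 := by
    ext z
    have h1 := hμ (x + z) trivial
    have h2 := hμ (x - z) trivial
    simp at h1 h2
    simpa using le_antisymm h1 h2
  simp [this]

theorem stmt_18 {X Y : Type*} [NormedAddCommGroup X] [NormedSpace ℝ X] [CompleteSpace X]
    [NormedAddCommGroup Y] [NormedSpace ℝ Y] [CompleteSpace Y]
    (hrefl : IsReflexiveSpace X)
    (A : X →L[ℝ] Y) (hrange : IsClosed (Set.range A)) (b : Y)
    (xbar : X) (hfeas : A xbar = b) :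
    (Mset (fun z => A z - b) (fun _ => A) Set.univ ({0} : Set Y) xbar 0 =
      {v : X →L[ℝ] ℝ | ∃ l : Y →L[ℝ] ℝ, v = l.comp A}) ∧
    (∀ (x : X) (r : ℝ), 0 ≤ r →
      Mset (fun z => A z - b) (fun _ => A) Set.univ ({0} : Set Y) x r ⊆
        Mset (fun z => A z - b) (fun _ => A) Set.univ ({0} : Set Y) xbar 0) ∧
    wAKKTRegular (fun z => A z - b) (fun _ => A) Set.univ ({0} : Set Y) xbar := by
  have key : Mset (fun z => A z - b) (fun _ => A) Set.univ ({0} : Set Y) xbar 0 =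
      {v : X →L[ℝ] ℝ | ∃ l : Y →L[ℝ] ℝ, v = l.comp A} := by
    ext v
    refine ⟨factor_of_mem_Mset A b xbar 0 v, ?_⟩
    rintro ⟨l, rfl⟩
    exact ⟨l, 0, ⟨trivial, by simp⟩, by simp [hfeas], by simp⟩
  refine ⟨key, ?_, ?_⟩
  · intro x r _ v hv
    rw [key]
    exact factor_of_mem_Mset A b x r v hv
  · intro v0 x r v _ _ hv hM
    rw [key]
    refine factor_of_closed_range A hrange v0 (fun z hz => ?_)
    have h0 : ∀ k, v k z = 0 := by
      intro k
      obtain ⟨l, hl⟩ := factor_of_mem_Mset A b _ _ _ (hM k)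
      simp [hl, hz]
    have h1 := hv z
    simp only [h0] at h1
    exact tendsto_nhds_unique h1 tendsto_const_nhds
end
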